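/- arXiv:2407.15785 — 4 statements merged into one kernel-verified Lean document; each statement's English description precedes it below -/
import Mathlib

section
/- Let m, k be positive integers, let H be a finite group, and let φ : H → Aut(Z_m) be a group homomorphism satisfying property (*). Then any subset S of size k of (Z_m ⋊_φ H) \ {0} is weakly Freiman isomorphic (of order k) to a subset S' of size k of (Z ⋊_φ' H) \ {0}, where φ' : H → Aut(Z) is the homomorphism with φ'(h) = id when φ(h) = id and φ'(h)(x) = −x when φ(h)(x) = −x, provided that every prime factor of m is greater than k!. -/
/-- `f` is a weak Freiman homomorphism of order `k` from `S` (in the ambient group `V`)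
to `S'` (in the ambient group `W`): it maps `S` into `S'` and for every tuple of at most
`k` distinct elements of `S` whose (ordered) product is the identity, the corresponding
tuple of images also has product equal to the identity. -/
def IsWeakFreimanHom {V W : Type*} [Group V] [Group W] (k : ℕ)
    (S : Finset V) (S' : Finset W) (f : V → W) : Prop :=
  (∀ x ∈ S, f x ∈ S') ∧
    ∀ l : List V, l.Nodup → (∀ x ∈ l, x ∈ S) → l.length ≤ k →
      l.prod = 1 → (l.map f).prod = 1

/-- `f` is a weak Freiman isomorphism of order `k` from `S` to `S'`: a bijection from
`S` onto `S'` such that both `f` and its inverse are weak Freiman homomorphisms of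
order `k`. -/
def IsWeakFreimanIso {V W : Type*} [Group V] [Group W] (k : ℕ)
    (S : Finset V) (S' : Finset W) (f : V → W) : Prop :=
  Set.BijOn f ↑S ↑S' ∧ IsWeakFreimanHom k S S' f ∧
    ∃ g : W → V, (∀ x ∈ S, g (f x) = x) ∧ (∀ y ∈ S', f (g y) = y) ∧
      IsWeakFreimanHom k S' S g

open scoped Nat Matrix in
/-- If the integer vector `c` lies in the rational span of a set `E` of integer vectors with
entries in `{-1, 0, 1}`, then a nonzero multiple `d • c` with `|d| ≤ n!` lies in the integer
span of `E`, where `n` is the dimension. -/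
theorem exists_smul_mem_span_int {ι : Type*} [Fintype ι] [DecidableEq ι]
    (E : Set (ι → ℤ)) (hE : ∀ e ∈ E, ∀ i, |e i| ≤ 1) (c : ι → ℤ)
    (hc : (fun i => (c i : ℚ)) ∈
      Submodule.span ℚ ((fun (e : ι → ℤ) i => (e i : ℚ)) '' E)) :
    ∃ d : ℤ, d ≠ 0 ∧ |d| ≤ (Fintype.card ι)! ∧ d • c ∈ Submodule.span ℤ E := by
  classical
  set K : (ι → ℤ) → (ι → ℚ) := fun e i => (e i : ℚ) with hK
  have K_inj : Function.Injective K := fun a b h =>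
    funext fun i => Int.cast_injective (congrFun h i)
  obtain ⟨b, hbE, hb_span, hb⟩ := exists_linearIndependent ℚ (K '' E)
  let T : Set (ι → ℤ) := E ∪ Set.range fun i => Pi.single i 1
  have hT : ∀ e ∈ T, ∀ i, |e i| ≤ 1 := by
    rintro e (he | ⟨j, rfl⟩) i
    · exact hE e he i
    · by_cases h : i = j
      · subst h; simp
      · simp [h]
  have hbT : b ⊆ K '' T := hbE.trans (Set.image_mono Set.subset_union_left)
  have hT_span : ⊤ ≤ Submodule.span ℚ (K '' T) := by
    rw [← (Pi.basisFun ℚ ι).span_eq, Submodule.span_le]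
    rintro _ ⟨i, rfl⟩
    refine Submodule.subset_span ⟨Pi.single i 1, Or.inr ⟨i, rfl⟩, ?_⟩
    ext j
    by_cases h : j = i
    · subst h; simp [hK]
    · simp [hK, h]
  let B₀ := Module.Basis.extendLe (s := b) hb hbT hT_span
  let B := B₀.reindex (B₀.indexEquiv (Pi.basisFun ℚ ι))
  have hB_range : Set.range B = Set.range B₀ := B₀.range_reindex _
  have hBT : ∀ j, ∃ e ∈ T, K e = B j := fun j =>
    Module.Basis.extendLe_subset (s := b) hb hbT hT_span (hB_range ▸ Set.mem_range_self j)
  have hbB : b ⊆ Set.range B :=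
    hB_range ▸ Module.Basis.subset_extendLe (s := b) hb hbT hT_span
  choose M hMT hMB using hBT
  let M' : Matrix ι ι ℤ := Matrix.of M
  have hM_map : M'.map (Int.cast : ℤ → ℚ) = Matrix.of B := by
    ext i j
    exact congrFun (hMB i) j
  have hM_adj : (M'.adjugate).map (Int.cast : ℤ → ℚ) = (Matrix.of B).adjugate := by
    rw [← hM_map]
    exact (Int.castRingHom ℚ).map_adjugate M'
  have hdet : (M'.det : ℚ) = (Matrix.of B).det := by
    rw [← hM_map]
    exact (Int.castRingHom ℚ).map_det M'
  have hc_repr : K c = B.repr (K c) ᵥ* Matrix.of B := by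
    rw [Matrix.vecMul_eq_sum]
    exact (B.sum_repr (K c)).symm
  have hcoeff : ∀ j, (((c ᵥ* M'.adjugate) j : ℤ) : ℚ) = M'.det * B.repr (K c) j := by
    intro j
    have h1 : (((c ᵥ* M'.adjugate) j : ℤ) : ℚ) =
        (K c ᵥ* (M'.adjugate).map (Int.cast : ℤ → ℚ)) j := by
      simp [Matrix.vecMul, dotProduct, hK]
    rw [h1, hM_adj, hdet]
    conv_lhs => rw [hc_repr]
    rw [Matrix.vecMul_vecMul, Matrix.mul_adjugate, Matrix.vecMul_smul, Matrix.vecMul_one]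
    rfl
  refine ⟨M'.det, ?_, ?_, ?_⟩
  · intro h0
    have hli := Matrix.linearIndependent_rows_iff_isUnit.mp
      (show LinearIndependent ℚ (Matrix.of B).row from B.linearIndependent)
    rw [Matrix.isUnit_iff_isUnit_det, ← hdet, h0] at hli
    simp at hli
  · have := Matrix.det_le (A := M') (abv := AbsoluteValue.abs) (x := 1)
      fun i j => hT _ (hMT i) j
    simpa using this
  · have h : M'.det • c = ∑ j, (c ᵥ* M'.adjugate) j • M j := by
      rw [show (∑ j, (c ᵥ* M'.adjugate) j • M j) = (c ᵥ* M'.adjugate) ᵥ* M' from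
        (Matrix.vecMul_eq_sum _ _).symm,
        Matrix.vecMul_vecMul, Matrix.adjugate_mul, Matrix.vecMul_smul, Matrix.vecMul_one]
    rw [h]
    refine Submodule.sum_mem _ fun j _ => ?_
    by_cases hj : B j ∈ b
    · obtain ⟨e, he, heB⟩ := hbE hj
      rw [← K_inj (heB.trans (hMB j).symm)]
      exact Submodule.smul_mem _ _ (Submodule.subset_span he)
    · have hsupp : ↑(B.repr (K c)).support ⊆ B ⁻¹' b := by
        refine B.repr_support_subset_of_mem_span _ ?_
        rwa [Set.image_preimage_eq_of_subset hbB, hb_span]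
      have h0 : B.repr (K c) j = 0 := by
        by_contra hne
        exact hj (hsupp (Finsupp.mem_support_iff.mpr hne))
      have h1 := hcoeff j
      rw [h0, mul_zero, Int.cast_eq_zero] at h1
      rw [h1, zero_smul]
      exact Submodule.zero_mem _

/-- A finite family of integer vectors avoiding a rational subspace `V` can be kept away from
zero by an integral linear form that vanishes on the integer vectors of `V`. -/
theorem exists_int_form_eq_zero_iff {ι : Type*} [Fintype ι] [DecidableEq ι]
    (V : Submodule ℚ (ι → ℚ)) {C : Set (ι → ℤ)} (hC : C.Finite) :
    ∃ y : ι → ℤ, ∀ c ∈ C, ∑ i, c i * y i = 0 ↔ (fun i => (c i : ℚ)) ∈ V := by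
  let C' : Set (ι → ℤ) := {c ∈ C | (fun i => (c i : ℚ)) ∉ V}
  have : Finite C' := hC.subset (Set.sep_subset _ _)
  obtain ⟨f, hf⟩ := Module.exists_dual_forall_apply_ne_zero (K := ℚ)
    (fun c : C' => V.mkQ fun i => (c.1 i : ℚ))
    fun c => by simpa using c.2.2
  obtain ⟨N, hN⟩ := IsLocalization.exist_integer_multiples_of_finite (nonZeroDivisors ℤ)
    fun i => f (V.mkQ (Pi.single i 1))
  choose y hy using hN
  have hN0 : (N : ℤ) ≠ 0 := nonZeroDivisors.coe_ne_zero N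
  have key : ∀ c : ι → ℤ, ((∑ i, c i * y i : ℤ) : ℚ) =
      (N : ℤ) * f (V.mkQ fun i => (c i : ℚ)) := by
    intro c
    have hsum : (fun i => (c i : ℚ)) = ∑ i, (c i : ℚ) • (Pi.single i 1 : ι → ℚ) := by
      simpa using pi_eq_sum_univ' fun i => (c i : ℚ)
    rw [hsum, map_sum, map_sum, Finset.mul_sum, Int.cast_sum]
    refine Finset.sum_congr rfl fun i _ => ?_
    have := hy i
    simp only [eq_intCast, zsmul_eq_mul] at this
    rw [map_smul, map_smul, Int.cast_mul, this, smul_eq_mul]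
    ring
  refine ⟨y, fun c hc => ?_⟩
  rw [← Int.cast_eq_zero (α := ℚ), key, mul_eq_zero, Int.cast_eq_zero, or_iff_right hN0]
  refine ⟨fun h => ?_, fun h => ?_⟩
  · by_contra hcV
    exact hf ⟨c, hc, hcV⟩ h
  · rw [Submodule.mkQ_apply, (Submodule.Quotient.mk_eq_zero V).mpr h, map_zero]

open scoped Nat in
/-- If all prime factors of `m` exceed `n!`, then any `n` residues modulo `m` can be replaced by
integers satisfying the same homogeneous linear relations with coefficients in `{-1, 0, 1}`. -/
theorem ZMod.exists_int_same_relations {ι : Type*} [Fintype ι] [DecidableEq ι] (m : ℕ)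
    (hprime : ∀ p : ℕ, p.Prime → p ∣ m → (Fintype.card ι)! < p) (x : ι → ZMod m) :
    ∃ y : ι → ℤ, ∀ c : ι → ℤ, (∀ i, |c i| ≤ 1) →
      (∑ i, c i • x i = 0 ↔ ∑ i, c i * y i = 0) := by
  let C : Set (ι → ℤ) := {c | ∀ i, |c i| ≤ 1}
  have hC : C.Finite := by
    refine (Set.finite_Icc (fun _ => -1 : ι → ℤ) fun _ => 1).subset fun c hc => ?_
    exact ⟨fun i => (abs_le.mp (hc i)).1, fun i => (abs_le.mp (hc i)).2⟩
  let L := Fintype.linearCombination ℤ x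
  let E : Set (ι → ℤ) := {c ∈ C | L c = 0}
  obtain ⟨y, hy⟩ := exists_int_form_eq_zero_iff
    (Submodule.span ℚ ((fun (e : ι → ℤ) i => (e i : ℚ)) '' E)) hC
  refine ⟨y, fun c hc => ?_⟩
  rw [hy c hc]
  refine ⟨fun h => Submodule.subset_span ⟨c, ⟨hc, h⟩, rfl⟩, fun h => ?_⟩
  obtain ⟨d, hd0, hd, hdc⟩ := exists_smul_mem_span_int E (fun e he => he.1) c h
  have hLE : Submodule.span ℤ E ≤ LinearMap.ker L := Submodule.span_le.mpr fun e he => he.2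
  have hLd : (d : ZMod m) * L c = 0 := by
    have : L (d • c) = 0 := hLE hdc
    rwa [LinearMap.map_smul, zsmul_eq_mul] at this
  have hcop : IsCoprime d (m : ℤ) := by
    rw [Int.isCoprime_iff_nat_coprime, Int.natAbs_natCast]
    refine Nat.coprime_of_dvd fun p hp hpd hpm => ?_
    have h1 := Nat.le_of_dvd (Int.natAbs_pos.mpr hd0) hpd
    have h2 := hprime p hp hpm
    rw [Int.abs_eq_natAbs, Nat.cast_le] at hd
    omega
  have hunit : IsUnit (d : ZMod m) := by
    have := hcop.map (Int.castRingHom (ZMod m))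
    simpa [isCoprime_zero_right] using this
  exact hunit.mul_right_eq_zero.mp hLd

/-- The signs with which the first components of the elements of `H` indexed by a list enter the
first component of their product in a semidirect product, when `h` acts as multiplication
by `s h`. -/
def semidirectCoeff {ι H : Type*} [DecidableEq ι] (s : H → ℤ) (h : ι → H) : List ι → ι → ℤ
  | [] => 0
  | a :: l => Pi.single a 1 + s (h a) • semidirectCoeff s h l

theorem semidirectCoeff_eq_zero {ι H : Type*} [DecidableEq ι] (s : H → ℤ) (h : ι → H)
    {l : List ι} {i : ι} (hi : i ∉ l) : semidirectCoeff s h l i = 0 := by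
  induction l with
  | nil => rfl
  | cons a l ih =>
    rw [List.mem_cons, not_or] at hi
    simp [semidirectCoeff, hi.1, ih hi.2]

theorem abs_semidirectCoeff_le_one {ι H : Type*} [DecidableEq ι] {s : H → ℤ}
    (hs : ∀ g, |s g| ≤ 1) (h : ι → H) {l : List ι} (hl : l.Nodup) (i : ι) :
    |semidirectCoeff s h l i| ≤ 1 := by
  induction l with
  | nil => simp [semidirectCoeff]
  | cons a l ih =>
    rw [List.nodup_cons] at hl
    by_cases hi : i = a
    · subst hi
      simp [semidirectCoeff, semidirectCoeff_eq_zero s h hl.1]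
    · simpa [semidirectCoeff, hi, abs_mul] using
        mul_le_one₀ (hs (h a)) (abs_nonneg _) (ih hl.2)

theorem SemidirectProduct.right_list_prod {ι N G : Type*} [Group N] [Group G]
    {φ : G →* MulAut N} (x : ι → N) (h : ι → G) (l : List ι) :
    (l.map fun i => (⟨x i, h i⟩ : N ⋊[φ] G)).prod.right = (l.map h).prod := by
  induction l with
  | nil => rfl
  | cons a l ih => simp only [List.map_cons, List.prod_cons, mul_right, ih]

theorem SemidirectProduct.left_list_prod {ι N G : Type*} [Fintype ι] [DecidableEq ι]
    [CommGroup N] [Group G] {φ : G →* MulAut N} {s : G → ℤ} (hs : ∀ g x, φ g x = x ^ s g)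
    (x : ι → N) (h : ι → G) (l : List ι) :
    (l.map fun i => (⟨x i, h i⟩ : N ⋊[φ] G)).prod.left =
      ∏ i, x i ^ semidirectCoeff s h l i := by
  induction l with
  | nil => simp [semidirectCoeff]
  | cons a l ih =>
    have h1 : ∏ i, x i ^ (Pi.single a 1 : ι → ℤ) i = x a := by
      rw [Fintype.prod_eq_single a fun i hi => by simp [hi]]
      simp
    simp only [List.map_cons, List.prod_cons, mul_left, ih, hs, semidirectCoeff, Pi.add_apply,
      Pi.smul_apply, smul_eq_mul, zpow_add, Finset.prod_mul_distrib, h1, mul_comm (s (h a)),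
      zpow_mul, Finset.prod_zpow]

/-- A map that is injective on `S` and preserves and reflects vanishing products of distinct
elements of `S` is a weak Freiman isomorphism onto its image. -/
theorem isWeakFreimanIso_image {V W : Type*} [Group V] [Group W] [DecidableEq W] (k : ℕ)
    {S : Finset V} {f : V → W} (hf : Set.InjOn f S)
    (h : ∀ l : List V, l.Nodup → (∀ x ∈ l, x ∈ S) → (l.prod = 1 ↔ (l.map f).prod = 1)) :
    IsWeakFreimanIso k S (S.image f) f := by
  let g : W → V := Function.invFunOn f S
  have hgf : ∀ x ∈ S, g (f x) = x := fun x hx => hf.leftInvOn_invFunOn hx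
  have hgS : ∀ y ∈ S.image f, g y ∈ S := by
    intro y hy
    obtain ⟨x, hx, rfl⟩ := Finset.mem_image.mp hy
    rwa [hgf x hx]
  have hfg : ∀ y ∈ S.image f, f (g y) = y := by
    intro y hy
    obtain ⟨x, hx, rfl⟩ := Finset.mem_image.mp hy
    rw [hgf x hx]
  refine ⟨by simpa using hf.bijOn_image, ⟨fun x hx => Finset.mem_image_of_mem f hx,
    fun l hl hlS _ => (h l hl hlS).mp⟩, g, hgf, hfg, hgS, fun l hl hlS _ hprod => ?_⟩
  have hl' : (l.map g).map f = l := by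
    rw [List.map_map]
    exact (List.map_congr_left fun y hy => hfg y (hlS y hy)).trans l.map_id'
  rw [h (l.map g) (List.Nodup.of_map f (hl'.symm ▸ hl)) ?_, hl', hprod]
  intro x hx
  obtain ⟨y, hy, rfl⟩ := List.mem_map.mp hx
  exact hgS y (hlS y hy)

/-- Any subset of size `k` of `(ℤ_m ⋊_φ H) \ {0}`, where `φ` satisfies property (*),
is weakly Freiman isomorphic (of order `k`) to a subset of size `k` of
`(ℤ ⋊_φ' H) \ {0}`, provided every prime factor of `m` exceeds `k!`. -/
theorem semidirect_weak_freiman_iso (m k : ℕ) (hm : 0 < m) (hk : 0 < k)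
    (H : Type*) [Group H] [Fintype H]
    (φ : H →* MulAut (Multiplicative (ZMod m)))
    (hφ : ∀ h : H, (∀ x, φ h x = x) ∨ (∀ x, φ h x = x⁻¹))
    (φ' : H →* MulAut (Multiplicative ℤ))
    (hφφ' : ∀ h : H, ((∀ x, φ h x = x) → ∀ x, φ' h x = x) ∧
      ((∀ x, φ h x = x⁻¹) → ∀ x, φ' h x = x⁻¹))
    (hprime : ∀ p : ℕ, p.Prime → p ∣ m → Nat.factorial k < p)
    (S : Finset (SemidirectProduct (Multiplicative (ZMod m)) H φ))
    (hcard : S.card = k) (h1 : (1 : SemidirectProduct (Multiplicative (ZMod m)) H φ) ∉ S) :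
    ∃ (S' : Finset (SemidirectProduct (Multiplicative ℤ) H φ'))
      (f : SemidirectProduct (Multiplicative (ZMod m)) H φ →
        SemidirectProduct (Multiplicative ℤ) H φ'),
      S'.card = k ∧ (1 : SemidirectProduct (Multiplicative ℤ) H φ') ∉ S' ∧
        IsWeakFreimanIso k S S' f := by
  classical
  have hsign : ∀ h : H, ∃ s : ℤ, |s| ≤ 1 ∧ (∀ x, φ h x = x ^ s) ∧ ∀ x, φ' h x = x ^ s := by
    intro h
    rcases hφ h with hh | hh
    · exact ⟨1, by simp, by simpa using hh, by simpa using (hφφ' h).1 hh⟩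
    · exact ⟨-1, by simp, by simpa using hh, by simpa using (hφφ' h).2 hh⟩
  choose s hs hsφ hsφ' using hsign
  let r : S → H := fun v => v.1.right
  let x : S → ZMod m := fun v => v.1.left.toAdd
  obtain ⟨y, hy⟩ := ZMod.exists_int_same_relations m (by simpa [hcard] using hprime) x
  let f : SemidirectProduct (Multiplicative (ZMod m)) H φ →
      SemidirectProduct (Multiplicative ℤ) H φ' := fun v =>
    if hv : v ∈ S then ⟨Multiplicative.ofAdd (y ⟨v, hv⟩), v.right⟩ else 1
  have hfS : ∀ v : S, f v = ⟨Multiplicative.ofAdd (y v), r v⟩ := fun v => by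
    simp [f, r]
  have hlist : ∀ l : List _, l.Nodup → (∀ v ∈ l, v ∈ S) →
      (l.prod = 1 ↔ (l.map f).prod = 1) := by
    intro l hl hlS
    lift l to List S using hlS
    have hl' : l.Nodup := hl.of_map _
    have h₁ : l.map Subtype.val = l.map fun i =>
        (⟨Multiplicative.ofAdd (x i), r i⟩ :
          SemidirectProduct (Multiplicative (ZMod m)) H φ) := rfl
    have h₂ : (l.map Subtype.val).map f = l.map fun i =>
        (⟨Multiplicative.ofAdd (y i), r i⟩ :
          SemidirectProduct (Multiplicative ℤ) H φ') := by
      rw [List.map_map]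
      exact List.map_congr_left fun v _ => hfS v
    rw [h₂, h₁, SemidirectProduct.ext_iff, SemidirectProduct.ext_iff,
      SemidirectProduct.right_list_prod, SemidirectProduct.right_list_prod,
      SemidirectProduct.left_list_prod hsφ, SemidirectProduct.left_list_prod hsφ']
    refine and_congr ?_ Iff.rfl
    have := hy _ (abs_semidirectCoeff_le_one hs r hl')
    simpa only [← ofAdd_zsmul, ← ofAdd_sum, SemidirectProduct.one_left, ofAdd_eq_one,
      smul_eq_mul] using this
  have hinj : Set.InjOn f S := by
    intro u hu v hv huv
    lift u to S using hu
    lift v to S using hv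
    rw [hfS, hfS, SemidirectProduct.ext_iff] at huv
    obtain ⟨hyuv, hr⟩ := huv
    by_contra hne
    have hne' : u ≠ v := fun h => hne (congrArg _ h)
    have := hy (Pi.single u 1 - Pi.single v 1) fun i => by
      by_cases hiu : i = u
      · subst hiu; simp [hne']
      · by_cases hiv : i = v
        · subst hiv; simp [hiu]
        · simp [hiu, hiv]
    simp only [Pi.sub_apply, sub_smul, sub_mul, Finset.sum_sub_distrib, Pi.single_apply,
      ite_smul, ite_mul, one_smul, one_mul, zero_smul, zero_mul, Finset.sum_ite_eq',
      Finset.mem_univ, if_true, sub_eq_zero] at this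
    exact hne (SemidirectProduct.ext (this.mpr hyuv) hr)
  refine ⟨S.image f, f, by rw [Finset.card_image_of_injOn hinj, hcard], ?_,
    isWeakFreimanIso_image k hinj hlist⟩
  intro hmem
  obtain ⟨v, hv, hv1⟩ := Finset.mem_image.mp hmem
  have := (hlist [v] (by simp) (by simpa using hv)).mpr (by simpa using hv1)
  rw [List.prod_singleton] at this
  exact h1 (this ▸ hv)
end

section
/- Let S be a subset of size k of Z_m \ {0}. Then S is sequenceable provided that every prime factor of m is greater than k!/2. -/
/-- A finite subset `S` of an additive group is *sequenceable* if there is an ordering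
`(x₁, …, x_k)` of its elements such that the partial sums `s₀ = 0`,
`s_i = x₁ + ⋯ + x_i` are pairwise distinct, with the possible exception that
`s_k = s₀` is allowed. -/
def IsAddSequenceable {G : Type*} [AddGroup G] (S : Finset G) : Prop :=
  ∃ l : List G, l.Nodup ∧ (∀ x, x ∈ l ↔ x ∈ S) ∧
    ∀ i j : ℕ, i < j → j ≤ l.length → ¬(i = 0 ∧ j = l.length) →
      (l.take i).sum ≠ (l.take j).sum

open Matrix

theorem List.Nodup.sum_eq_sum_finset {M : Type*} [AddCommMonoid M] {l : List M} (hl : l.Nodup)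
    {S : Finset M} (h : ∀ x, x ∈ l ↔ x ∈ S) : l.sum = ∑ x ∈ S, x := by
  classical
  obtain rfl : l.toFinset = S := by
    ext x
    simpa using h x
  simpa using (List.sum_toFinset id hl).symm

theorem List.exists_interval_sum_ne_zero {G : Type*} [AddCommGroup G]
    [LinearOrder G] [IsOrderedAddMonoid G]
    (S : Finset G) (h0 : (0 : G) ∉ S) (hS : ∑ x ∈ S, x ≠ 0 ∨ S = ∅) :
    ∃ l : List G, l.Nodup ∧ (∀ x, x ∈ l ↔ x ∈ S) ∧ l.Pairwise (fun x y => 0 < y → 0 < x) ∧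
      ∀ u, u <:+: l → u ≠ [] → u.sum ≠ 0 := by
  classical
  induction hn : S.card generalizing S with
  | zero =>
    obtain rfl := Finset.card_eq_zero.mp hn
    exact ⟨[], by simp⟩
  | succ n ih =>
    have hne : S ≠ ∅ := by rintro rfl; simp at hn
    replace hS : ∑ x ∈ S, x ≠ 0 := hS.resolve_right hne
    wlog hpos : 0 < ∑ x ∈ S, x generalizing S
    · have hinj : Set.InjOn (Neg.neg : G → G) S := neg_injective.injOn
      have hsum : ∑ x ∈ S.image Neg.neg, x = - ∑ x ∈ S, x := by
        rw [Finset.sum_image hinj, Finset.sum_neg_distrib]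
      obtain ⟨l, h1, h2, h3, h4⟩ := this (S.image Neg.neg) (by simpa using h0)
        (by rw [Finset.card_image_of_injOn hinj, hn]) (by simpa using hne)
        (by rw [hsum]; simpa using hS)
        (by rw [hsum]; exact neg_pos.mpr (lt_of_le_of_ne (not_lt.mp hpos) hS))
      have hmem : ∀ x, x ∈ (l.map Neg.neg).reverse ↔ x ∈ S := by
        intro x
        simp [h2]
      refine ⟨(l.map Neg.neg).reverse, ?_, hmem, ?_, ?_⟩
      · exact List.nodup_reverse.mpr (h1.map neg_injective)
      · rw [List.pairwise_reverse, List.pairwise_map]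
        refine h3.imp_of_mem fun {a b} ha hb hab h => ?_
        have hb0 : b ≠ 0 := by
          rintro rfl
          exact h0 (by simpa using (h2 0).mp hb)
        by_contra hcon
        have : 0 < a := hab (lt_of_le_of_ne (by simpa using hcon) hb0.symm)
        exact lt_asymm this (neg_pos.mp h)
      · intro u hu hu0 hus
        have : (u.map Neg.neg).reverse <:+: l := by
          have := (List.reverse_infix.mpr hu).map (Neg.neg : G → G)
          simpa using this
        refine h4 _ this (by simpa using hu0) ?_
        rw [← List.sum_neg_reverse, hus, neg_zero]
    · have key : ∃ a ∈ S, 0 < a ∧ (∑ x ∈ S.erase a, x ≠ 0 ∨ S.erase a = ∅) := by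
        obtain ⟨a, ha, ha0⟩ := (show ∃ a ∈ S, 0 < a by
          by_contra! hcon
          exact hpos.not_ge (Finset.sum_nonpos hcon))
        by_cases h : ∑ x ∈ S.erase a, x ≠ 0 ∨ S.erase a = ∅
        · exact ⟨a, ha, ha0, h⟩
        push Not at h
        obtain ⟨b, hb, hb0⟩ : ∃ b ∈ S.erase a, 0 < b := by
          by_contra! hcon
          obtain ⟨c, hc⟩ := h.2
          have := (Finset.sum_eq_zero_iff_of_nonpos hcon).mp h.1 c hc
          exact h0 (this ▸ Finset.mem_of_mem_erase hc)
        refine ⟨b, Finset.mem_of_mem_erase hb, hb0, Or.inl fun hz => ?_⟩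
        have e1 := Finset.add_sum_erase S id ha
        have e2 := Finset.add_sum_erase S id (Finset.mem_of_mem_erase hb)
        simp only [id] at e1 e2
        rw [h.1] at e1
        rw [hz] at e2
        exact Finset.ne_of_mem_erase hb (by simpa using e2.trans e1.symm)
      obtain ⟨a, ha, ha0, hsum⟩ := key
      obtain ⟨l, h1, h2, h3, h4⟩ := ih (S.erase a) (fun h => h0 (Finset.mem_of_mem_erase h)) hsum
        (by rw [Finset.card_erase_of_mem ha, hn]; rfl)
      have hnd : (a :: l).Nodup := by simp [h1, h2]
      have hmem : ∀ x, x ∈ a :: l ↔ x ∈ S := by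
        intro x
        by_cases hx : x = a <;> simp [h2, hx, ha]
      have hpw : (a :: l).Pairwise (fun x y => 0 < y → 0 < x) :=
        List.pairwise_cons.mpr ⟨fun _ _ _ => ha0, h3⟩
      refine ⟨a :: l, hnd, hmem, hpw, fun u hu hu0 hus => ?_⟩
      rcases List.infix_cons_iff.mp hu with ⟨v, hv⟩ | hu
      · have htot : (a :: l).sum = ∑ x ∈ S, x := hnd.sum_eq_sum_finset hmem
        rw [← hv, List.sum_append, hus, zero_add] at htot
        rw [← hv, List.pairwise_append] at hpw
        obtain ⟨c, hc, hc0⟩ : ∃ c ∈ v, 0 < c := by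
          by_contra! hcon
          exact hpos.not_ge (by simpa [htot] using List.sum_le_card_nsmul v 0 hcon)
        exact (List.sum_pos u (fun x hx => hpw.2.2 x hx c hc hc0) hu0).ne' hus
      · exact h4 u hu hu0 hus

theorem List.exists_proper_interval_sum_ne_zero {G : Type*} [AddCommGroup G]
    [LinearOrder G] [IsOrderedAddMonoid G]
    (S : Finset G) (h0 : (0 : G) ∉ S) :
    ∃ l : List G, l.Nodup ∧ (∀ x, x ∈ l ↔ x ∈ S) ∧
      ∀ u, u <:+: l → u ≠ [] → u ≠ l → u.sum ≠ 0 := by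
  classical
  by_cases hS : ∑ x ∈ S, x ≠ 0 ∨ S = ∅
  · obtain ⟨l, h1, h2, -, h3⟩ := exists_interval_sum_ne_zero S h0 hS
    exact ⟨l, h1, h2, fun u hu hu0 _ => h3 u hu hu0⟩
  push Not at hS
  obtain ⟨hsum, a, ha⟩ := hS
  have ha0 : a ≠ 0 := fun h => h0 (h ▸ ha)
  have htot := Finset.add_sum_erase S id ha
  simp only [id, hsum] at htot
  obtain ⟨l, h1, h2, -, h3⟩ := exists_interval_sum_ne_zero (S.erase a)
    (fun h => h0 (Finset.mem_of_mem_erase h))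
    (Or.inl fun h => ha0 (by simpa [h] using htot))
  have hl : l.sum = ∑ x ∈ S.erase a, x := h1.sum_eq_sum_finset h2
  refine ⟨a :: l, by simp [h1, h2], fun x => ?_, fun u hu hu0 hul hus => ?_⟩
  · by_cases hx : x = a <;> simp [h2, hx, ha]
  rcases List.infix_cons_iff.mp hu with ⟨v, hv⟩ | hu
  · have hvs : v.sum = 0 := by
      have := congrArg List.sum hv
      rwa [List.sum_append, hus, zero_add, List.sum_cons, hl, htot] at this
    obtain ⟨b, u, rfl⟩ := List.exists_cons_of_ne_nil hu0
    rw [List.cons_append, List.cons.injEq] at hv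
    refine h3 v (hv.2 ▸ (List.suffix_append u v).isInfix) ?_ hvs
    rintro rfl
    exact hul (by simpa using hv)
  · exact h3 u hu hu0 hus

theorem Matrix.two_mul_abs_det_le_factorial {ι : Type*} [Fintype ι] [DecidableEq ι] [Nontrivial ι]
    (N : Matrix ι ι ℤ) (hN : ∀ i j, N i j = 0 ∨ N i j = 1) :
    2 * |N.det| ≤ (Fintype.card ι).factorial := by
  have hprod (σ : Equiv.Perm ι) : ∏ i, N (σ i) i = 0 ∨ ∏ i, N (σ i) i = 1 := by
    by_cases h : ∃ i, N (σ i) i = 0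
    · obtain ⟨i, hi⟩ := h
      exact Or.inl (Finset.prod_eq_zero (Finset.mem_univ i) hi)
    · push Not at h
      exact Or.inr (Finset.prod_eq_one fun i _ => (hN _ _).resolve_left (h i))
  have hones : (Matrix.of fun _ _ => 1 : Matrix ι ι ℤ).det = 0 := by
    obtain ⟨i, j, hij⟩ := exists_pair_ne ι
    exact Matrix.det_zero_of_row_eq hij rfl
  have hdet : 2 * N.det = ∑ σ : Equiv.Perm ι, (σ.sign : ℤ) * (2 * ∏ i, N (σ i) i - 1) := by
    rw [← sub_zero (2 * N.det), ← hones, Matrix.det_apply', Matrix.det_apply', Finset.mul_sum,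
      ← Finset.sum_sub_distrib]
    refine Finset.sum_congr rfl fun σ _ => ?_
    simp only [Int.cast_id, Matrix.of_apply, Finset.prod_const_one]
    ring
  calc 2 * |N.det| = |2 * N.det| := by rw [abs_mul]; rfl
    _ ≤ ∑ σ : Equiv.Perm ι, |(σ.sign : ℤ) * (2 * ∏ i, N (σ i) i - 1)| := by
      rw [hdet]; exact Finset.abs_sum_le_sum_abs _ _
    _ = ∑ σ : Equiv.Perm ι, 1 := by
      refine Finset.sum_congr rfl fun σ _ => ?_
      rw [abs_mul, Int.isUnit_iff_abs_eq.mp σ.sign.isUnit, one_mul]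
      rcases hprod σ with h | h <;> rw [h] <;> rfl
    _ = (Fintype.card ι).factorial := by simp [Fintype.card_perm]

theorem Matrix.exists_det_ne_zero_of_mem_span {K ι κ : Type*} [Field K] [Fintype ι] [DecidableEq ι]
    (v : κ → ι → K) (hv : Submodule.span K (Set.range v) = ⊤) (T : Set κ) (w : ι → K)
    (hw : w ∈ Submodule.span K (v '' T)) :
    ∃ (g : ι → κ) (c : ι → K), (Matrix.of fun i => v (g i)).det ≠ 0 ∧
      c ᵥ* (Matrix.of fun i => v (g i)) = w ∧ ∀ i, g i ∉ T → c i = 0 := by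
  obtain ⟨B₀, hB₀T, -, hspan₀, hli₀⟩ :=
    exists_linearIndepOn_extension (linearIndepOn_empty K v) (Set.empty_subset T)
  obtain ⟨B, -, hB₀B, hspan, hli⟩ :=
    exists_linearIndepOn_extension hli₀ (Set.subset_univ B₀)
  have htop : ⊤ ≤ Submodule.span K (Set.range fun b : B => v b) := by
    rw [← hv, Submodule.span_le]
    rwa [Set.image_univ, Set.image_eq_range] at hspan
  have hli' : LinearIndependent K fun b : B => v b := hli
  let b : Module.Basis B K (ι → K) := Module.Basis.mk hli' htop
  let e : ι ≃ B := (Pi.basisFun K ι).indexEquiv b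
  let b' := b.reindex e.symm
  have hb' (i : ι) : b' i = v (e i) := by
    rw [Module.Basis.reindex_apply, Equiv.symm_symm]
    exact Module.Basis.mk_apply hli' htop (e i)
  have hw' : w ∈ Submodule.span K (b' '' {i | (e i : κ) ∈ T}) := by
    refine Submodule.span_le.mpr hspan₀ |>.trans (Submodule.span_mono ?_) hw
    rintro _ ⟨t, ht, rfl⟩
    exact ⟨e.symm ⟨t, hB₀B ht⟩, by simpa using hB₀T ht, by simp [hb']⟩
  refine ⟨fun i => e i, b'.repr w, ?_, ?_, fun i hi => ?_⟩
  · have hrow : LinearIndependent K (Matrix.of fun i => v (e i)).row := by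
      have := b'.linearIndependent
      rwa [show (b' : ι → ι → K) = fun i => v (e i) from funext hb'] at this
    exact ((Matrix.isUnit_iff_isUnit_det _).mp
      (Matrix.linearIndependent_rows_iff_isUnit.mp hrow)).ne_zero
  · conv_rhs => rw [← b'.sum_repr w]
    rw [Matrix.vecMul_eq_sum]
    exact Finset.sum_congr rfl fun i _ => by rw [hb']; rfl
  · by_contra hne
    exact hi (b'.mem_span_image.mp hw' (Finsupp.mem_support_iff.mpr hne))

/-- An integer linear form that is a rational combination of subset sums is annihilated, up to the
determinant of a `0`-`1` matrix, wherever these subset sums vanish. -/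
theorem exists_abs_le_factorial_mul_eq_zero {R ι : Type*} [CommRing R] [Fintype ι] [DecidableEq ι]
    (T : Set (Finset ι)) (w : ι → ℤ)
    (hw : (fun i => (w i : ℚ)) ∈
      Submodule.span ℚ ((fun A i => if i ∈ A then (1 : ℚ) else 0) '' T))
    (x : ι → R) (hx : ∀ A ∈ T, ∑ i ∈ A, x i = 0) :
    ∃ d : ℤ, d ≠ 0 ∧ 2 * |d| ≤ max 2 ((Fintype.card ι).factorial : ℤ) ∧
      (d : R) * ∑ i, (w i : R) * x i = 0 := by
  obtain ⟨g, c, hdet, hc, hcT⟩ := Matrix.exists_det_ne_zero_of_mem_span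
    (fun (A : Finset ι) i => if i ∈ A then (1 : ℚ) else 0)
    (by
      rw [eq_top_iff, ← (Pi.basisFun ℚ ι).span_eq]
      refine Submodule.span_mono ?_
      rintro _ ⟨i, rfl⟩
      exact ⟨{i}, by ext j; simp [Pi.single_apply]⟩) T _ hw
  let N : Matrix ι ι ℤ := Matrix.of fun i j => if j ∈ g i then 1 else 0
  have hN : (Matrix.of fun i j => if j ∈ g i then (1 : ℚ) else 0) = N.map (Int.castRingHom ℚ) := by
    ext i j
    simp [N]
  rw [hN] at hdet hc
  have hdetQ : (N.map (Int.castRingHom ℚ)).det = N.det := (RingHom.map_det _ N).symm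
  have ha (i : ι) (hi : g i ∉ T) : (w ᵥ* N.adjugate) i = 0 := by
    have hcast : (Int.castRingHom ℚ) ((w ᵥ* N.adjugate) i) = N.det * c i := by
      rw [RingHom.map_vecMul, ← RingHom.mapMatrix_apply, RingHom.map_adjugate,
        RingHom.mapMatrix_apply, ← hdetQ]
      change ((fun i => (w i : ℚ)) ᵥ* _) i = _
      rw [← hc, Matrix.vecMul_vecMul, Matrix.mul_adjugate, Matrix.vecMul_smul, Matrix.vecMul_one]
      rfl
    rw [hcT i hi, mul_zero] at hcast
    exact Int.cast_injective (α := ℚ) (by simpa using hcast)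
  refine ⟨N.det, fun h => hdet (by rw [hdetQ, h, Int.cast_zero]), ?_, ?_⟩
  · rcases subsingleton_or_nontrivial ι with h | h
    · refine le_max_of_le_left ?_
      rcases isEmpty_or_nonempty ι with h' | ⟨⟨i⟩⟩
      · simp
      · rw [Matrix.det_eq_elem_of_subsingleton N i]
        simp only [N, Matrix.of_apply]
        split_ifs <;> simp
    · refine le_max_of_le_right (Matrix.two_mul_abs_det_le_factorial N fun i j => ?_)
      simp only [N, Matrix.of_apply]
      split_ifs <;> simp
  · let f := Int.castRingHom R
    have hNx (i : ι) (hi : g i ∈ T) : (N.map f *ᵥ x) i = 0 := by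
      rw [← hx _ hi]
      simp [Matrix.mulVec, dotProduct, N, Finset.sum_ite_mem]
    calc (N.det : R) * ∑ i, (w i : R) * x i
        = (f ∘ w) ⬝ᵥ (f N.det • x) := by rw [dotProduct_smul]; rfl
      _ = (f ∘ w) ⬝ᵥ ((N.adjugate.map f) *ᵥ (N.map f *ᵥ x)) := by
        rw [Matrix.mulVec_mulVec, ← RingHom.mapMatrix_apply, ← RingHom.mapMatrix_apply, ← map_mul,
          Matrix.adjugate_mul]
        simp
      _ = ∑ i, ((f ∘ w) ᵥ* (N.adjugate.map f)) i * (N.map f *ᵥ x) i := by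
        rw [Matrix.dotProduct_mulVec]; rfl
      _ = 0 := Finset.sum_eq_zero fun i _ => by
        by_cases hi : g i ∈ T
        · rw [hNx i hi, mul_zero]
        · rw [← RingHom.map_vecMul, ha i hi, map_zero, zero_mul]

/-- Unless it is in the span of the indicator vectors of a family of sets, a vector is not
orthogonal to all vectors whose sums over these sets vanish. -/
theorem exists_sum_eq_zero_and_sum_mul_ne_zero {K ι : Type*} [Field K] [Fintype ι] [DecidableEq ι]
    (T : Set (Finset ι)) (w : ι → K)
    (hw : w ∉ Submodule.span K ((fun A i => if i ∈ A then (1 : K) else 0) '' T)) :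
    ∃ y : ι → K, (∀ A ∈ T, ∑ i ∈ A, y i = 0) ∧ ∑ i, w i * y i ≠ 0 := by
  obtain ⟨φ, hφw, hφ⟩ := Submodule.exists_dual_map_eq_bot_of_notMem hw inferInstance
  have hφ' (u : ι → K) : φ u = ∑ i, u i * φ (Pi.single i 1) := by
    conv_lhs => rw [pi_eq_sum_univ u]
    rw [map_sum]
    refine Finset.sum_congr rfl fun i _ => ?_
    rw [map_smul, smul_eq_mul]
    congr 2
    ext j
    simp [Pi.single_apply, eq_comm]
  refine ⟨fun i => φ (Pi.single i 1), fun A hA => ?_, by rwa [← hφ']⟩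
  have : φ (fun i => if i ∈ A then (1 : K) else 0) = 0 := by
    have := Submodule.mem_map_of_mem (f := φ) (Submodule.subset_span
      (Set.mem_image_of_mem (fun (A : Finset ι) i => if i ∈ A then (1 : K) else 0) hA))
    rwa [hφ, Submodule.mem_bot] at this
  rw [hφ'] at this
  simpa [Finset.sum_ite_mem] using this

theorem ZMod.eq_zero_of_intCast_mul_eq_zero {m : ℕ} {d : ℤ} (hd : d ≠ 0)
    (hlt : ∀ p : ℕ, p.Prime → p ∣ m → |d| < p) {a : ZMod m} (h : (d : ZMod m) * a = 0) : a = 0 := by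
  have hcop : Nat.Coprime d.natAbs m := by
    refine Nat.Coprime.symm (Nat.coprime_of_dvd fun p hp hpm hpd => ?_)
    have h1 := Nat.le_of_dvd (Int.natAbs_pos.mpr hd) hpd
    have h2 := hlt p hp hpm
    rw [Int.abs_eq_natAbs] at h2
    omega
  have hu : IsUnit (d : ZMod m) := by
    have := (ZMod.isUnit_iff_coprime _ _).mpr hcop
    rcases Int.natAbs_eq d with h | h <;> rw [h] <;> simpa using this
  exact hu.mul_right_eq_zero.mp h

/-- Rational labels, nonzero and distinct, on which all vanishing subset sums still vanish. -/
theorem exists_injective_rat_sum_eq_zero {m : ℕ} (S : Finset (ZMod m)) (h0 : (0 : ZMod m) ∉ S)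
    (hprime : ∀ p : ℕ, p.Prime → p ∣ m → S.card.factorial < 2 * p) :
    ∃ y : S → ℚ, Function.Injective y ∧ (∀ i, y i ≠ 0) ∧
      ∀ A : Finset S, ∑ i ∈ A, (i : ZMod m) = 0 → ∑ i ∈ A, y i = 0 := by
  classical
  let T : Set (Finset S) := {A | ∑ i ∈ A, (i : ZMod m) = 0}
  let V : Submodule ℚ (S → ℚ) :=
    { carrier := {y | ∀ A ∈ T, ∑ i ∈ A, y i = 0}
      add_mem' := fun {a b} ha hb A hA => by simp [Finset.sum_add_distrib, ha A hA, hb A hA]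
      zero_mem' := by simp
      smul_mem' := fun c a ha A hA => by simp [← Finset.mul_sum, ha A hA] }
  have key (w : S → ℤ) (hw : ∑ i, (w i : ZMod m) * i ≠ 0) :
      ∃ y ∈ V, ∑ i, (w i : ℚ) * y i ≠ 0 := by
    refine exists_sum_eq_zero_and_sum_mul_ne_zero T (fun i => (w i : ℚ)) fun hmem => hw ?_
    obtain ⟨d, hd, hle, hmul⟩ :=
      exists_abs_le_factorial_mul_eq_zero T w hmem (fun i : S => (i : ZMod m)) fun A hA => hA
    refine ZMod.eq_zero_of_intCast_mul_eq_zero hd (fun p hp hpm => ?_) hmul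
    have h1 := hprime p hp hpm
    have h2 := hp.two_le
    rw [Fintype.card_coe] at hle
    rcases le_max_iff.mp hle with h | h <;> omega
  let P := {q : S × S // q.1 ≠ q.2}
  let f : S ⊕ P → Module.Dual ℚ (S → ℚ) :=
    Sum.elim (fun i => LinearMap.proj (φ := fun _ => ℚ) i)
      fun q => LinearMap.proj (R := ℚ) (φ := fun _ => ℚ) q.1.1 -
        LinearMap.proj (R := ℚ) (φ := fun _ => ℚ) q.1.2
  obtain ⟨y, hyV, hy⟩ := Module.Dual.exists_forall_mem_ne_zero_of_forall_exists V f (by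
    rintro (i | ⟨⟨i, j⟩, hij⟩)
    · obtain ⟨y, hyV, hy⟩ := key (Pi.single i 1) (by
        simpa [Pi.single_apply] using fun h : (i : ZMod m) = 0 => h0 (h ▸ i.2))
      exact ⟨y, hyV, by simpa [f, Pi.single_apply] using hy⟩
    · obtain ⟨y, hyV, hy⟩ := key (Pi.single i 1 - Pi.single j 1) (by
        simpa [Pi.single_apply, sub_mul, sub_eq_zero] using Subtype.coe_ne_coe.mpr hij)
      exact ⟨y, hyV, by simpa [f, Pi.single_apply, sub_mul] using hy⟩)
  refine ⟨y, fun i j hij => ?_, fun i => hy (Sum.inl i), hyV⟩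
  by_contra hne
  exact hy (Sum.inr ⟨(i, j), hne⟩) (sub_eq_zero.mpr hij)

/-- Any subset of size `k` of `ℤ_m \ {0}` is sequenceable provided that every prime
factor of `m` is greater than `k!/2`. -/
theorem zmod_sequenceable_of_large_prime_factors (m k : ℕ) (hm : 0 < m) (hk : 0 < k)
    (hprime : ∀ p : ℕ, p.Prime → p ∣ m → Nat.factorial k < 2 * p)
    (S : Finset (ZMod m)) (hcard : S.card = k) (h0 : (0 : ZMod m) ∉ S) :
    IsAddSequenceable S := by
  classical
  subst hcard
  obtain ⟨y, hinj, hne, hy⟩ := exists_injective_rat_sum_eq_zero S h0 hprime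
  obtain ⟨l, h1, h2, h3⟩ := List.exists_proper_interval_sum_ne_zero (Finset.univ.image y)
    (by simpa using hne)
  obtain ⟨l, rfl⟩ : l ∈ Set.range (List.map y) := by
    rw [Set.range_list_map]
    exact fun x hx => by simpa using (h2 x).mp hx
  have hnd : l.Nodup := h1.of_map
  have hmem (i : S) : i ∈ l := by
    simpa [hinj.eq_iff] using (h2 (y i)).mpr (by simp)
  refine ⟨l.map (↑), hnd.map Subtype.val_injective, by simp [hmem], fun i j hij hj hijl hsum => ?_⟩
  rw [List.length_map] at hj hijl
  let u := (l.take j).drop i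
  have hu : u <:+: l := (List.drop_suffix _ _).isInfix.trans (List.take_prefix _ _).isInfix
  have hlen : u.length = j - i := by simp [u, hj]
  have hu0 : (u.map y).sum = 0 := by
    have hund : u.Nodup := hnd.sublist hu.sublist
    rw [← List.sum_toFinset y hund]
    refine hy _ ?_
    rw [List.sum_toFinset _ hund]
    have hsplit : l.take j = l.take i ++ u := by
      conv_lhs => rw [← List.take_append_drop i (l.take j), List.take_take, min_eq_left hij.le]
    rw [← List.map_take, ← List.map_take, hsplit, List.map_append, List.sum_append] at hsum
    simpa using hsum.symm
  refine h3 (u.map y) (hu.map y) (fun h => ?_) (fun h => ?_) hu0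
  · have := congrArg List.length h
    simp only [List.length_map, List.length_nil] at this
    omega
  · have := congrArg List.length h
    simp only [List.length_map] at this
    omega
end

section
/- Every finite subset S of Z \ {0} is sequenceable. -/
theorem sum_take_lt_sum_take {l : List ℤ} (hl : ∀ x ∈ l, 0 < x) {i j : ℕ} (hij : i < j)
    (hj : j ≤ l.length) : (l.take i).sum < (l.take j).sum := by
  induction l generalizing i j with
  | nil => simp at hj; omega
  | cons x l ih =>
    obtain ⟨j, rfl⟩ : ∃ k, j = k + 1 := ⟨j - 1, by omega⟩
    have hx : 0 < x := hl x (by simp)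
    have hl' : ∀ y ∈ l, 0 < y := fun y hy => hl y (by simp [hy])
    cases i with
    | zero =>
      have : 0 ≤ (l.take j).sum :=
        List.sum_nonneg fun y hy => (hl' y (List.mem_of_mem_take hy)).le
      simp only [List.take_zero, List.sum_nil, List.take_succ_cons, List.sum_cons]
      omega
    | succ i =>
      have := ih hl' (i := i) (j := j) (by omega) (by simpa using hj)
      simpa using this

theorem sum_eq_of_toFinset_eq {l : List ℤ} {A : Finset ℤ} (hl : l.Nodup) (hA : l.toFinset = A) :
    l.sum = ∑ a ∈ A, a := by
  rw [← hA, List.sum_toFinset _ hl, List.map_id']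

/-- The grasshopper lemma: distinct positive jumps starting at `c` can be ordered so that no
landing point lies in a set `M` with fewer points beyond `c` than there are jumps, provided that
the final landing point is not in `M`. -/
theorem exists_list_forall_prefix_sum_notMem (A M : Finset ℤ) (c : ℤ) (hA : ∀ a ∈ A, 0 < a)
    (hM : (M.filter (c < ·)).card < A.card) (hc : c + ∑ a ∈ A, a ∉ M) :
    ∃ l : List ℤ, l.Nodup ∧ l.toFinset = A ∧ ∀ t, t <+: l → t ≠ [] → c + t.sum ∉ M := by
  induction hn : A.card using Nat.strong_induction_on generalizing A M c with
  | _ n ih =>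
  subst hn
  have hne : A.Nonempty := Finset.card_pos.mp (by omega)
  obtain ⟨a, haA, hmax⟩ : ∃ a ∈ A, ∀ b ∈ A, b ≤ a := A.exists_max_image id hne
  have ha := hA a haA
  have hcard := Finset.card_erase_of_mem haA
  have hsum := Finset.add_sum_erase A (fun x => x) haA
  have hpos : ∀ b ∈ A.erase a, 0 < b := fun b hb => hA b (Finset.mem_of_mem_erase hb)
  set K := M.filter (c < ·) with hK
  have memK : ∀ x, x ∈ K ↔ x ∈ M ∧ c < x := fun x => by simp [hK]
  rcases K.eq_empty_or_nonempty with hKe | hKn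
  · refine ⟨A.toList, A.nodup_toList, A.toList_toFinset, fun t ht hne' hmem => ?_⟩
    have : 0 < t.sum := List.sum_pos _ (fun x hx => hA x (by simpa using ht.subset hx)) hne'
    have h : c + t.sum ∈ K := (memK _).2 ⟨hmem, by omega⟩
    simp [hKe] at h
  obtain ⟨d, hdK, hmin⟩ : ∃ d ∈ K, ∀ b ∈ K, d ≤ b := K.exists_min_image id hKn
  obtain ⟨hdM, hcd⟩ := (memK d).1 hdK
  have hKd := Finset.card_erase_of_mem hdK
  have hKpos := Finset.card_pos.mpr hKn
  rcases lt_or_ge d (c + a) with hda | hda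
  · by_cases haM : c + a ∈ M
    · have haK : c + a ∈ K.erase d :=
        Finset.mem_erase.2 ⟨by omega, (memK _).2 ⟨haM, by omega⟩⟩
      have hKda := Finset.card_erase_of_mem haK
      have hKda' := Finset.card_pos.mpr ⟨_, haK⟩
      obtain ⟨b, hb, hb1, hb2⟩ : ∃ b ∈ A.erase a, c + b ∉ M ∧ c + b + a ∉ M := by
        by_contra! hcon
        have hKa := Finset.card_erase_of_mem (Finset.mem_of_mem_erase haK)
        have hlt : ∀ b ∈ A.erase a, b < a := fun b hb =>
          lt_of_le_of_ne (hmax b (Finset.mem_of_mem_erase hb)) (Finset.ne_of_mem_erase hb)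
        have := Finset.card_le_card_of_injOn (s := A.erase a) (t := K.erase (c + a))
          (fun b => if c + b ∈ M then c + b else c + b + a)
          (fun b hb => by
            have h0 := hpos b hb
            have h1 := hlt b hb
            have h2 := hcon b hb
            simp only [Finset.coe_erase, Set.mem_sdiff, Finset.mem_coe, Set.mem_singleton_iff, memK]
            split_ifs with h
            · exact ⟨⟨h, by omega⟩, by omega⟩
            · exact ⟨⟨h2 h, by omega⟩, by omega⟩)
          (fun b hb b' hb' h => by
            have h0 := hpos b hb
            have h1 := hlt b hb
            have h0' := hpos b' hb'
            have h1' := hlt b' hb'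
            dsimp only at h
            split_ifs at h <;> omega)
        omega
      have hcard' := Finset.card_erase_of_mem hb
      have hsum' := Finset.add_sum_erase (A.erase a) (fun x => x) hb
      have hb0 := hpos b hb
      have hsub : M.filter (c + b + a < ·) ⊆ (K.erase d).erase (c + a) := fun x hx => by
        simp only [Finset.mem_filter] at hx
        simp only [Finset.mem_erase, memK]
        exact ⟨by omega, by omega, hx.1, by omega⟩
      have := Finset.card_le_card hsub
      obtain ⟨l, hl, hlA, hlM⟩ := ih _ (by omega) ((A.erase a).erase b) M (c + b + a)
        (fun x hx => hpos x (Finset.mem_of_mem_erase hx)) (by omega)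
        (by rwa [add_assoc, add_assoc, add_left_comm b, hsum', hsum]) rfl
      have hmem : ∀ x, x ∈ l ↔ x ∈ (A.erase a).erase b := fun x => by rw [← hlA, List.mem_toFinset]
      refine ⟨b :: a :: l, ?_, ?_, ?_⟩
      · simp [hl, hmem, Finset.ne_of_mem_erase hb]
      · rw [List.toFinset_cons, List.toFinset_cons, hlA, Finset.erase_right_comm,
          Finset.insert_erase, Finset.insert_erase]
        · exact Finset.mem_of_mem_erase hb
        · exact Finset.mem_erase.2 ⟨(Finset.ne_of_mem_erase hb).symm, haA⟩
      · intro t ht hne'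
        rcases List.prefix_cons_iff.1 ht with rfl | ⟨u, rfl, hu⟩
        · exact absurd rfl hne'
        rcases List.prefix_cons_iff.1 hu with rfl | ⟨v, rfl, hv⟩
        · simpa using hb1
        rcases eq_or_ne v [] with rfl | hvn
        · simpa [add_assoc] using hb2
        · simpa [add_assoc] using hlM v hv hvn
    · have hsub : M.filter (c + a < ·) ⊆ K.erase d := fun x hx => by
        simp only [Finset.mem_filter] at hx
        simp only [Finset.mem_erase, memK]
        exact ⟨by omega, hx.1, by omega⟩
      have := Finset.card_le_card hsub
      obtain ⟨l, hl, hlA, hlM⟩ := ih _ (by omega) (A.erase a) M (c + a) hpos (by omega)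
        (by rwa [add_assoc, hsum]) rfl
      have hmem : ∀ x, x ∈ l ↔ x ∈ A.erase a := fun x => by rw [← hlA, List.mem_toFinset]
      refine ⟨a :: l, by simp [hl, hmem], ?_, ?_⟩
      · rw [List.toFinset_cons, hlA, Finset.insert_erase haA]
      · intro t ht hne'
        rcases List.prefix_cons_iff.1 ht with rfl | ⟨u, rfl, hu⟩
        · exact absurd rfl hne'
        rcases eq_or_ne u [] with rfl | hun
        · simpa using haM
        · simpa [add_assoc] using hlM u hu hun
  · have hsub : (M.erase d).filter (c + a < ·) ⊆ K.erase d := fun x hx => by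
      simp only [Finset.mem_filter, Finset.mem_erase] at hx
      simp only [Finset.mem_erase, memK]
      exact ⟨hx.1.1, hx.1.2, by omega⟩
    have := Finset.card_le_card hsub
    obtain ⟨l, hl, hlA, hlM⟩ := ih _ (by omega) (A.erase a) (M.erase d) (c + a) hpos (by omega)
      (by rw [add_assoc, hsum]; exact fun h => hc (Finset.mem_of_mem_erase h)) rfl
    have hmem : ∀ x, x ∈ l ↔ x ∈ A.erase a := fun x => by rw [← hlA, List.mem_toFinset]
    have hlsum := sum_eq_of_toFinset_eq hl hlA
    have hnd : (a :: l).Nodup := by simp [hl, hmem]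
    have hfin : (a :: l).toFinset = A := by
      rw [List.toFinset_cons, hlA, Finset.insert_erase haA]
    have avoid : ∀ t, t <+: l → c + a + t.sum ≠ d → c + a + t.sum ∉ M := fun t ht htd => by
      rcases eq_or_ne t [] with rfl | htn
      · intro h
        have := hmin (c + a + List.sum []) ((memK _).2 ⟨h, by simp; omega⟩)
        simp at this htd
        omega
      · exact fun h => hlM t ht htn (Finset.mem_erase.2 ⟨htd, h⟩)
    by_cases hit : ∃ t, t <+: l ∧ c + a + t.sum = d
    · obtain ⟨t, ⟨r, rfl⟩, htd⟩ := hit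
      cases r with
      | nil =>
        simp only [List.append_nil] at hlsum
        refine absurd hdM ?_
        rwa [← htd, hlsum, add_assoc, hsum]
      | cons z r =>
        have happ : t ++ z :: a :: r = (t ++ [z]) ++ a :: r := by simp
        have hperm : (t ++ z :: a :: r).Perm (a :: (t ++ z :: r)) := by
          rw [happ, List.append_cons t z r]
          exact List.perm_middle
        have hz := (hmem z).1 (by simp)
        have hz0 := hpos z hz
        have hza : z < a :=
          lt_of_le_of_ne (hmax z (Finset.mem_of_mem_erase hz)) (Finset.ne_of_mem_erase hz)
        have early : ∀ u, u <+: t ++ [z] → u ≠ [] → c + u.sum ∉ M := by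
          rintro u ⟨v, hv⟩ hun h
          have hpos' : ∀ x ∈ u ++ v, 0 < x := fun x hx => by
            rw [hv] at hx
            exact hpos x ((hmem x).1 (by
              rw [List.append_cons]
              exact List.mem_append_left _ hx))
          have hu0 : 0 < u.sum := List.sum_pos _ (fun x hx => hpos' x (by simp [hx])) hun
          have hv0 : 0 ≤ v.sum := List.sum_nonneg fun x hx => (hpos' x (by simp [hx])).le
          have hsum' := congrArg List.sum hv
          simp only [List.sum_append, List.sum_singleton] at hsum'
          have := hmin _ ((memK _).2 ⟨h, by omega⟩)
          omega
        refine ⟨t ++ z :: a :: r, hperm.nodup_iff.2 hnd,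
          (List.toFinset_eq_of_perm _ _ hperm).trans hfin, ?_⟩
        intro u hu hne'
        rw [happ] at hu
        rcases List.prefix_or_prefix_of_prefix hu (List.prefix_append _ _) with h | ⟨v, rfl⟩
        · exact early u h hne'
        rw [List.prefix_append_right_inj] at hu
        rcases List.prefix_cons_iff.1 hu with rfl | ⟨w, rfl, hw⟩
        · rw [List.append_nil] at hne' ⊢
          exact early _ List.prefix_rfl hne'
        have hw0 : 0 ≤ w.sum := List.sum_nonneg fun x hx =>
          (hpos x ((hmem x).1 (by simp [hw.subset hx]))).le
        have := avoid (t ++ z :: w) (by simpa using hw)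
          (by rw [List.sum_append, List.sum_cons]; omega)
        convert this using 2
        simp only [List.sum_append, List.sum_cons, List.sum_nil]
        ring
    · push Not at hit
      refine ⟨a :: l, hnd, hfin, ?_⟩
      intro t ht hne'
      rcases List.prefix_cons_iff.1 ht with rfl | ⟨u, rfl, hu⟩
      · exact absurd rfl hne'
      · simpa [add_assoc] using avoid u hu (hit u hu)

/-- Positive integers can be ordered so that no proper nonempty initial segment has a given sum
different from the total. -/
theorem exists_list_forall_sum_take_ne (A : Finset ℤ) (hA : ∀ a ∈ A, 0 < a) (s : ℤ)
    (hs : s ≠ ∑ a ∈ A, a) :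
    ∃ l : List ℤ, l.Nodup ∧ l.toFinset = A ∧
      ∀ i, 1 ≤ i → i < l.length → (l.take i).sum ≠ s := by
  rcases Nat.lt_or_ge 1 A.card with h | h
  · obtain ⟨l, hl, hlA, hls⟩ := exists_list_forall_prefix_sum_notMem A {s} 0 hA
      ((Finset.card_filter_le _ _).trans_lt (by simpa using h)) (by simpa using hs.symm)
    refine ⟨l, hl, hlA, fun i h1 hi => ?_⟩
    have := hls (l.take i) (List.take_prefix i l) (by
      rw [ne_eq, List.take_eq_nil_iff]
      rintro (h | rfl)
      · omega
      · simp at hi)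
    simpa using this
  · refine ⟨A.toList, A.nodup_toList, A.toList_toFinset, fun i h1 hi => ?_⟩
    rw [Finset.length_toList] at hi
    omega

theorem IsAddSequenceable.of_image_neg {S : Finset ℤ}
    (h : IsAddSequenceable (S.image (fun x => -x))) : IsAddSequenceable S := by
  obtain ⟨l, hl, hmem, hd⟩ := h
  refine ⟨l.map (fun x => -x), hl.map neg_injective, fun x => ?_, fun i j hij hj h0 => ?_⟩
  · have := hmem (-x)
    simp only [Finset.mem_image, neg_inj, exists_eq_right] at this
    rw [← this, List.mem_map]
    constructor
    · rintro ⟨y, hy, rfl⟩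
      simpa using hy
    · exact fun h => ⟨-x, h, neg_neg x⟩
  · rw [List.length_map] at hj h0
    rw [← List.map_take, ← List.map_take, ← List.sum_neg, ← List.sum_neg, ne_eq, neg_inj]
    exact hd i j hij hj h0

/-- Given positive sets `A`, `B`, the set `-A ∪ B` is sequenceable by first stepping through
`-A` and then climbing back through `B` while avoiding the points already visited. -/
theorem isAddSequenceable_of_card_le (A B S : Finset ℤ) (hA : ∀ a ∈ A, 0 < a)
    (hB : ∀ b ∈ B, 0 < b) (hS : ∀ x, x ∈ S ↔ -x ∈ A ∨ x ∈ B) (hle : A.card ≤ B.card)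
    (hlt : A.card < B.card ∨ ∑ b ∈ B, b ≤ ∑ a ∈ A, a) : IsAddSequenceable S := by
  rcases B.eq_empty_or_nonempty with rfl | hBn
  · have : A = ∅ := by simpa using hle
    subst this
    refine ⟨[], by simp, fun x => by simp [hS], fun i j hij hj _ => ?_⟩
    simp at hj
    omega
  have hBpos := Finset.card_pos.mpr hBn
  have hBsum : 0 < ∑ b ∈ B, b := Finset.sum_pos hB hBn
  obtain ⟨m, hm, hmA, hms⟩ := exists_list_forall_sum_take_ne A hA
    (∑ a ∈ A, a - ∑ b ∈ B, b) (by omega)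
  have hmsum := sum_eq_of_toFinset_eq hm hmA
  have hmlen : m.length = A.card := by rw [← hmA, List.toFinset_card_of_nodup hm]
  have hmmem : ∀ x, x ∈ m ↔ x ∈ A := fun x => by rw [← hmA, List.mem_toFinset]
  have hmpos : ∀ x ∈ m, 0 < x := fun x hx => hA x ((hmmem x).1 hx)
  set e : ℕ := if ∑ b ∈ B, b ≤ ∑ a ∈ A, a then 1 else 0 with he
  set M : Finset ℤ := (Finset.Ico e A.card).image (fun i => -(m.take i).sum) with hM
  have hMcard : M.card ≤ A.card - e := by
    simpa using Finset.card_image_le (s := Finset.Ico e A.card) (f := fun i => -(m.take i).sum)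
  obtain ⟨l, hl, hlB, hlM⟩ := exists_list_forall_prefix_sum_notMem B M (-∑ a ∈ A, a) hB
    ((Finset.card_filter_le _ _).trans_lt (by split_ifs at he <;> omega)) (by
      simp only [hM, Finset.mem_image, Finset.mem_Ico, not_exists, not_and]
      rintro i ⟨h1, h2⟩ h
      rcases Nat.eq_zero_or_pos i with rfl | hi
      · simp at h
        split_ifs at he <;> omega
      · exact hms i hi (by omega) (by omega))
  have hlsum := sum_eq_of_toFinset_eq hl hlB
  have hlmem : ∀ x, x ∈ l ↔ x ∈ B := fun x => by rw [← hlB, List.mem_toFinset]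
  have hlpos : ∀ x ∈ l, 0 < x := fun x hx => hB x ((hlmem x).1 hx)
  have hneg : ∀ x, x ∈ m.map (fun x => -x) ↔ -x ∈ A := fun x => by
    rw [List.mem_map, ← hmmem]
    constructor
    · rintro ⟨y, hy, rfl⟩
      simpa using hy
    · exact fun h => ⟨-x, h, neg_neg x⟩
  have htake : ∀ i, ((m.map (fun x => -x) ++ l).take i).sum =
      -(m.take i).sum + (l.take (i - m.length)).sum := fun i => by
    rw [List.take_append, List.sum_append, ← List.map_take, ← List.sum_neg, List.length_map]
  refine ⟨m.map (fun x => -x) ++ l, ?_, fun x => ?_, fun i j hij hj h0 => ?_⟩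
  · refine (hm.map neg_injective).append hl fun x hx hx' => ?_
    have h1 := hA _ ((hneg x).1 hx)
    have h2 := hlpos x hx'
    omega
  · rw [List.mem_append, hneg, hlmem, hS]
  · rw [List.length_append, List.length_map] at hj h0
    rw [htake, htake]
    rcases le_or_gt j m.length with hjm | hjm
    · rw [Nat.sub_eq_zero_of_le hjm, Nat.sub_eq_zero_of_le (hij.le.trans hjm)]
      have := sum_take_lt_sum_take hmpos hij hjm
      omega
    rw [List.take_of_length_le (i := j) hjm.le, hmsum]
    rcases le_or_gt m.length i with him | him
    · rw [List.take_of_length_le (i := i) him, hmsum]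
      have := sum_take_lt_sum_take hlpos (i := i - m.length) (j := j - m.length)
        (by omega) (by omega)
      omega
    rw [Nat.sub_eq_zero_of_le him.le, List.take_zero, List.sum_nil, add_zero]
    rcases Nat.lt_or_ge i e with hie | hie
    · have hi0 : i = 0 ∧ ∑ b ∈ B, b ≤ ∑ a ∈ A, a := by split_ifs at he <;> omega
      have := sum_take_lt_sum_take hlpos (i := j - m.length) (j := l.length)
        (by omega) le_rfl
      rw [List.take_length, hlsum] at this
      rw [hi0.1, List.take_zero, List.sum_nil]
      omega
    · intro h
      refine hlM (l.take (j - m.length)) (List.take_prefix _ _) ?_ ?_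
      · rw [ne_eq, List.take_eq_nil_iff]
        rintro (h | rfl)
        · omega
        · simp at hj
          omega
      · rw [← h]
        exact Finset.mem_image_of_mem _ (Finset.mem_Ico.2 ⟨hie, by omega⟩)

/-- Every finite subset of `ℤ \ {0}` is sequenceable. -/
theorem every_finite_subset_of_int_sequenceable (S : Finset ℤ) (hS : (0 : ℤ) ∉ S) :
    IsAddSequenceable S := by
  set P := S.filter (0 < ·) with hP
  set N := (S.filter (· < 0)).image (fun x => -x) with hN
  have hPpos : ∀ b ∈ P, 0 < b := fun b hb => (Finset.mem_filter.1 hb).2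
  have memN : ∀ x, x ∈ N ↔ -x ∈ S ∧ 0 < x := fun x => by
    simp only [hN, Finset.mem_image, Finset.mem_filter]
    constructor
    · rintro ⟨y, ⟨hy, hy0⟩, rfl⟩
      exact ⟨by simpa using hy, by omega⟩
    · rintro ⟨h1, h2⟩
      exact ⟨-x, ⟨h1, by omega⟩, neg_neg x⟩
  have hNpos : ∀ b ∈ N, 0 < b := fun b hb => ((memN b).1 hb).2
  have hSmem : ∀ x, x ∈ S ↔ -x ∈ N ∨ x ∈ P := fun x => by
    rw [memN, hP, Finset.mem_filter, neg_neg]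
    rcases lt_trichotomy x 0 with h | rfl | h
    · simp [h, h.le]
    · simp [hS]
    · simp [h, h.le]
  by_cases h : N.card ≤ P.card ∧ (N.card < P.card ∨ ∑ b ∈ P, b ≤ ∑ a ∈ N, a)
  · exact isAddSequenceable_of_card_le N P S hNpos hPpos hSmem h.1 h.2
  · refine IsAddSequenceable.of_image_neg
      (isAddSequenceable_of_card_le P N _ hPpos hNpos (fun x => ?_) (by omega) (by omega))
    simp only [Finset.mem_image]
    constructor
    · rintro ⟨y, hy, rfl⟩
      rw [neg_neg, or_comm]
      exact (hSmem y).1 hy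
    · exact fun h => ⟨-x, (hSmem _).2 (by rwa [neg_neg, or_comm]), neg_neg x⟩
end

section
/- Let H be a finite abelian strongly sequenceable group and let φ : H → Aut(Z) be a group homomorphism (so for each h ∈ H, φ(h) is either the identity or x ↦ −x). Then every finite subset S of (Z ⋊_φ H) \ {0} is sequenceable. -/
/-- A finite subset `S` of a group is *sequenceable* if there is an ordering
`(x₁, …, x_k)` of its elements such that the partial products `s₀ = 1`,
`s_i = x₁ ⋯ x_i` are pairwise distinct, with the possible exception that
`s_k = s₀` is allowed. -/
def IsSequenceable {G : Type*} [Group G] (S : Finset G) : Prop :=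
  ∃ l : List G, l.Nodup ∧ (∀ x, x ∈ l ↔ x ∈ S) ∧
    ∀ i j : ℕ, i < j → j ≤ l.length → ¬(i = 0 ∧ j = l.length) →
      (l.take i).prod ≠ (l.take j).prod

/-- A group is *strongly sequenceable* if every finite subset not containing the
identity is sequenceable. -/
def StronglySequenceable (G : Type*) [Group G] : Prop :=
  ∀ S : Finset G, (1 : G) ∉ S → IsSequenceable S

theorem List.prefix_append_iff_exists {α : Type*} {t a b : List α} :
    t <+: a ++ b ↔ t <+: a ∨ ∃ n, t = a ++ n ∧ n <+: b := by
  constructor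
  · rintro ⟨r, hr⟩
    rcases List.append_eq_append_iff.1 hr with ⟨c, hc, -⟩ | ⟨c, hc, hc'⟩
    · exact .inl ⟨c, hc.symm⟩
    · exact .inr ⟨c, hc, r, hc'.symm⟩
  · rintro (h | ⟨n, rfl, h⟩)
    · exact h.trans (List.prefix_append _ _)
    · simpa using h

/-- The partial products of `l` are pairwise distinct, up to the permitted exception, exactly when
no nonempty contiguous block of `l` other than `l` itself has product `1`. -/
theorem isSequenceable_iff_block {G : Type*} [Group G] (S : Finset G) :
    IsSequenceable S ↔ ∃ l : List G, l.Nodup ∧ (∀ x, x ∈ l ↔ x ∈ S) ∧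
      ∀ v, v <:+: l → v ≠ [] → v.prod = 1 → v = l := by
  refine exists_congr fun l => and_congr_right fun _ => and_congr_right fun _ => ⟨?_, ?_⟩
  · rintro h v ⟨a, b, rfl⟩ hv hp
    by_contra hne
    have hv' : 0 < v.length := List.length_pos_iff.2 hv
    refine h a.length (a ++ v).length (by simp; omega) (by simp) ?_ ?_
    · rintro ⟨h₁, h₂⟩
      have ha : a = [] := List.length_eq_zero_iff.1 h₁
      have hb : b = [] := by simpa using h₂
      simp [ha, hb] at hne
    · rw [List.append_assoc, List.take_left, ← List.append_assoc, List.take_left]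
      simp [hp]
  · intro h i j hij hj hne heq
    have hsplit : (l.take j) = l.take i ++ (l.take j).drop i := by
      conv_lhs => rw [← List.take_append_drop i (l.take j)]
      rw [List.take_take, min_eq_left hij.le]
    have hlen : ((l.take j).drop i).length = j - i := by simp [hj]
    have hv := h ((l.take j).drop i)
      ((List.drop_suffix _ _).isInfix.trans (List.IsPrefix.isInfix ⟨_, List.take_append_drop j l⟩))
      (fun h0 => by rw [h0] at hlen; simp at hlen; omega)
      (by rw [hsplit, List.prod_append] at heq; simpa using heq)
    rw [hv] at hlen
    omega

/-- Sequenceability of `S` can be tested on its image under a map that is injective on `S` and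
sends words over `S` with product `1` to words with product `1`. -/
theorem IsSequenceable.of_image {G K : Type*} [Group G] [Group K] [DecidableEq K] {S : Finset G}
    (f : G → K) (hinj : Set.InjOn f S)
    (hf : ∀ v : List G, (∀ x ∈ v, x ∈ S) → v.prod = 1 → (v.map f).prod = 1)
    (h : IsSequenceable (S.image f)) : IsSequenceable S := by
  rw [isSequenceable_iff_block] at h ⊢
  obtain ⟨l, hn, hm, hl⟩ := h
  have hlift : ∀ m : List K, (∀ y ∈ m, y ∈ S.image f) →
      ∃ k : List G, (∀ x ∈ k, x ∈ S) ∧ k.map f = m := by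
    intro m
    induction m with
    | nil => exact fun _ => ⟨[], by simp, rfl⟩
    | cons y m ih =>
      intro hy
      obtain ⟨k, hk, rfl⟩ := ih fun z hz => hy z (List.mem_cons_of_mem _ hz)
      obtain ⟨x, hx, rfl⟩ := Finset.mem_image.1 (hy y List.mem_cons_self)
      exact ⟨x :: k, by simpa [hx] using hk, rfl⟩
  obtain ⟨k, hk, rfl⟩ := hlift l fun y hy => (hm y).1 hy
  refine ⟨k, hn.of_map f, fun x => ⟨hk x, fun hx => ?_⟩, fun v hv hv0 hp => ?_⟩
  · obtain ⟨x', hx', he⟩ := List.mem_map.1 ((hm (f x)).2 (Finset.mem_image_of_mem f hx))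
    exact hinj (hk x' hx') hx he ▸ hx'
  · have := hl (v.map f) (hv.map f) (by simpa using hv0)
      (hf v (fun x hx => hk x (hv.subset hx)) hp)
    exact hv.eq_of_length (by simpa using congrArg List.length this)

section Additive

variable {C : Type*} [CommGroup C]

theorem prod_nonneg_of_additive {w : C → ℤ} (hw : ∀ x y, w (x * y) = w x + w y) (l : List C)
    (hl : ∀ x ∈ l, 0 < w x) : 0 ≤ w l.prod ∧ (l ≠ [] → 0 < w l.prod) := by
  have h1 : w 1 = 0 := by simpa using hw 1 1
  induction l with
  | nil => simp [h1]
  | cons a l ih =>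
    have := (ih fun x hx => hl x (List.mem_cons_of_mem _ hx)).1
    have := hl a List.mem_cons_self
    simp only [List.prod_cons, hw]
    exact ⟨by omega, fun _ => by omega⟩

theorem prod_nonpos_of_additive {w : C → ℤ} (hw : ∀ x y, w (x * y) = w x + w y) (l : List C)
    (hl : ∀ x ∈ l, w x < 0) : w l.prod ≤ 0 ∧ (l ≠ [] → w l.prod < 0) := by
  have := prod_nonneg_of_additive (w := fun x => - w x) (fun x y => by simp only [hw]; ring) l
    (fun x hx => by have := hl x hx; omega)
  exact ⟨by omega, fun h => by have := this.2 h; omega⟩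

theorem prod_eq_zero_of_additive {w : C → ℤ} (hw : ∀ x y, w (x * y) = w x + w y) (l : List C)
    (hl : ∀ x ∈ l, w x = 0) : w l.prod = 0 := by
  have h1 : w 1 = 0 := by simpa using hw 1 1
  induction l with
  | nil => simp [h1]
  | cons a l ih =>
    rw [List.prod_cons, hw, hl a List.mem_cons_self,
      ih fun x hx => hl x (List.mem_cons_of_mem _ hx), zero_add]

/-- Positive elements `P` and negative elements `N` can be ordered so that no initial block of `P`
cancels an initial block of `N`, up to the constant `m`. -/
theorem exists_orderings_prod_ne_one (w : C → ℤ) (hw : ∀ x y, w (x * y) = w x + w y) (m : C)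
    (hm : w m = 0) (P N : List C) (hP : ∀ x ∈ P, 0 < w x) (hN : ∀ x ∈ N, w x < 0)
    (hPn : P.Nodup) (hNn : N.Nodup) (h : P ≠ [] → N ≠ [] → P.prod * N.prod * m ≠ 1) :
    ∃ P' N' : List C, P'.Perm P ∧ N'.Perm N ∧
      ∀ p n, p <+: P' → n <+: N' → p ≠ [] → n ≠ [] → p.prod * n.prod * m ≠ 1 := by
  classical
  induction hk : P.length + N.length using Nat.strong_induction_on generalizing P N w with
  | _ k ih =>
  by_cases hP0 : P = []
  · refine ⟨P, N, .refl _, .refl _, fun p n hp _ hp0 => ?_⟩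
    subst hP0
    simp at hp
    contradiction
  by_cases hN0 : N = []
  · refine ⟨P, N, .refl _, .refl _, fun p n _ hn _ hn0 => ?_⟩
    subst hN0
    simp at hn
    contradiction
  wlog hge : 0 ≤ w P.prod + w N.prod generalizing P N w
  · obtain ⟨N', P', hN', hP', hh⟩ := this (fun x => - w x) (fun x y => by simp only [hw]; ring)
      (by simp only [hm]; rfl) N P (fun x hx => by have := hN x hx; omega)
      (fun x hx => by have := hP x hx; omega) hNn hPn
      (fun _ _ => by rw [mul_comm N.prod]; exact h hP0 hN0) (by omega) hN0 hP0
      (by omega)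
    exact ⟨P', N', hP', hN', fun p n hp hn hp0 hn0 => by
      rw [mul_comm p.prod]; exact hh n p hn hp hn0 hp0⟩
  have h1 : w 1 = 0 := by simpa using hw 1 1
  obtain ⟨a, ha, hab⟩ : ∃ a ∈ P, (P.erase a ≠ [] → (P.erase a).prod * N.prod * m ≠ 1) := by
    obtain ⟨a, Q, rfl⟩ := List.exists_cons_of_ne_nil hP0
    by_cases hQ : Q = []
    · exact ⟨a, by simp, by simp [hQ]⟩
    obtain ⟨b, R, rfl⟩ := List.exists_cons_of_ne_nil hQ
    have hne : a ≠ b := by rintro rfl; simp at hPn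
    by_contra! hcon
    have ea := (hcon a (by simp)).2
    have eb := (hcon b (by simp)).2
    rw [List.erase_cons_head] at ea
    rw [List.erase_cons_tail (by simpa using hne), List.erase_cons_head] at eb
    rw [← ea] at eb
    simp only [List.prod_cons] at eb
    exact hne (by simpa using eb)
  have hlen := List.length_erase_of_mem ha
  have hpos := List.length_pos_of_mem ha
  obtain ⟨Q, N', hQ, hN', hh⟩ := ih ((P.erase a).length + N.length) (by omega) w hw hm
    (P.erase a) N (fun x hx => hP x (List.mem_of_mem_erase hx)) hN (hPn.erase a) hNn
    (fun h _ => hab h) rfl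
  have hperm : (Q ++ [a]).Perm P :=
    (List.perm_append_singleton a Q).trans ((hQ.cons a).trans (List.perm_cons_erase ha).symm)
  refine ⟨Q ++ [a], N', hperm, hN', fun p n hp hn hp0 hn0 hprod => ?_⟩
  rcases List.prefix_concat_iff.1 hp with rfl | hp
  · obtain ⟨t, rfl⟩ := hn
    have hwp : w ((Q ++ [a]).prod * n.prod * m) = 0 := by rw [hprod, h1]
    have hNp : w N.prod = w n.prod + w t.prod := by rw [← hN'.prod_eq, List.prod_append, hw]
    rw [hw, hw, hm, hperm.prod_eq] at hwp
    by_cases ht : t = []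
    · subst ht
      rw [List.append_nil] at hN'
      exact h hP0 hN0 (by rw [← hN'.prod_eq, ← hperm.prod_eq]; exact hprod)
    · have := (prod_nonpos_of_additive hw t
        (fun x hx => hN x (hN'.subset (List.mem_append_right _ hx)))).2 ht
      omega
  · exact hh p n hp hn hp0 hn0 hprod

/-- As `exists_orderings_prod_ne_one`, but without assumption on the total product, at the cost of
allowing the complete blocks to cancel. -/
theorem exists_orderings_eq_of_prod_eq_one (w : C → ℤ) (hw : ∀ x y, w (x * y) = w x + w y) (m : C)
    (hm : w m = 0) (P N : List C) (hP : ∀ x ∈ P, 0 < w x) (hN : ∀ x ∈ N, w x < 0)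
    (hPn : P.Nodup) (hNn : N.Nodup) :
    ∃ P' N' : List C, P'.Perm P ∧ N'.Perm N ∧
      ∀ p n, p <+: P' → n <+: N' → p ≠ [] → n ≠ [] → p.prod * n.prod * m = 1 →
        p = P' ∧ n = N' := by
  by_cases h : P ≠ [] → N ≠ [] → P.prod * N.prod * m ≠ 1
  · obtain ⟨P', N', hP', hN', hh⟩ := exists_orderings_prod_ne_one w hw m hm P N hP hN hPn hNn h
    exact ⟨P', N', hP', hN', fun p n hp hn hp0 hn0 he => absurd he (hh p n hp hn hp0 hn0)⟩
  push Not at h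
  obtain ⟨hP0, hN0, hprod⟩ := h
  have h1 : w 1 = 0 := by simpa using hw 1 1
  obtain ⟨a, Q, rfl⟩ := List.exists_cons_of_ne_nil hP0
  obtain ⟨Q', N', hQ', hN', hh⟩ := exists_orderings_prod_ne_one w hw m hm Q N
    (fun x hx => hP x (List.mem_cons_of_mem _ hx)) hN hPn.of_cons hNn (fun _ _ he => by
      have ha := hP a List.mem_cons_self
      rw [List.prod_cons, mul_assoc, mul_assoc, ← mul_assoc Q.prod, he, mul_one] at hprod
      rw [hprod, h1] at ha
      exact lt_irrefl _ ha)
  have hperm : (Q' ++ [a]).Perm (a :: Q) := (List.perm_append_singleton a Q').trans (hQ'.cons a)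
  refine ⟨Q' ++ [a], N', hperm, hN', fun p n hp hn hp0 hn0 he => ?_⟩
  rcases List.prefix_concat_iff.1 hp with rfl | hp
  · refine ⟨rfl, ?_⟩
    obtain ⟨t, rfl⟩ := hn
    by_contra ht
    have hn_eq : n.prod = N.prod := by
      rw [hperm.prod_eq, ← hprod] at he
      simpa using he
    have hNp : w N.prod = w n.prod + w t.prod := by rw [← hN'.prod_eq, List.prod_append, hw]
    have := (prod_nonpos_of_additive hw t
      (fun x hx => hN x (hN'.subset (List.mem_append_right _ hx)))).2
      (by rintro rfl; simp at ht)
    rw [hn_eq] at hNp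
    omega
  · exact absurd he (hh p n hp hn hp0 hn0)

/-- Positive elements, a block of weight-zero elements and negative elements can be concatenated
to a sequencing, provided the middle block has no subblock with product `1`. -/
theorem exists_ascend_descend (w : C → ℤ) (hw : ∀ x y, w (x * y) = w x + w y) (P M N : List C)
    (hP : ∀ x ∈ P, 0 < w x) (hM : ∀ x ∈ M, w x = 0) (hN : ∀ x ∈ N, w x < 0)
    (hPn : P.Nodup) (hNn : N.Nodup)
    (hMs : ∀ v, v <:+: M → v ≠ [] → v.prod ≠ 1) :
    ∃ P' N' : List C, P'.Perm P ∧ N'.Perm N ∧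
      ∀ v, v <:+: P' ++ (M ++ N') → v ≠ [] → v.prod = 1 → v = P' ++ (M ++ N') := by
  have h1 : w 1 = 0 := by simpa using hw 1 1
  obtain ⟨R, N', hR, hN', hh⟩ := exists_orderings_eq_of_prod_eq_one w hw M.prod
    (prod_eq_zero_of_additive hw M hM) P N hP hN hPn hNn
  have hPp : R.reverse.Perm P := (List.reverse_perm R).trans hR
  refine ⟨R.reverse, N', hPp, hN', fun v hv hv0 hprod => ?_⟩
  have posP : ∀ s, s <:+: R.reverse → s ≠ [] → 0 < w s.prod := fun s hs hs0 =>
    (prod_nonneg_of_additive hw s fun x hx => hP x (hPp.subset (hs.subset hx))).2 hs0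
  have negN : ∀ s, s <:+: N' → s ≠ [] → w s.prod < 0 := fun s hs hs0 =>
    (prod_nonpos_of_additive hw s fun x hx => hN x (hN'.subset (hs.subset hx))).2 hs0
  have zeroM : ∀ s, s <:+: M → w s.prod = 0 := fun s hs =>
    prod_eq_zero_of_additive hw s fun x hx => hM x (hs.subset hx)
  have hwv : w v.prod = 0 := by rw [hprod, h1]
  rcases List.infix_append_iff_ne_nil.1 hv with hv | hv | ⟨s, t, hs0, ht0, rfl, hs, ht⟩
  · exact absurd hwv (posP v hv hv0).ne'
  · rcases List.infix_append_iff_ne_nil.1 hv with hv | hv | ⟨s, t, hs0, ht0, rfl, hs, ht⟩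
    · exact absurd hprod (hMs v hv hv0)
    · exact absurd hwv (negN v hv hv0).ne
    · have := negN t ht.isInfix ht0
      have := zeroM s hs.isInfix
      rw [List.prod_append, hw] at hwv
      omega
  · have hspos := posP s hs.isInfix hs0
    rw [List.prod_append, hw] at hwv
    rcases List.prefix_append_iff_exists.1 ht with ht | ⟨n, rfl, hn⟩
    · have := zeroM t ht.isInfix
      omega
    · by_cases hn0 : n = []
      · subst hn0
        have := zeroM M List.infix_rfl
        rw [List.append_nil] at hwv
        omega
      · have := hh s.reverse n (List.reverse_suffix.1 (by simpa using hs)) hn (by simpa using hs0)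
          hn0 (by
            rw [← hprod, (List.reverse_perm s).prod_eq]
            simp only [List.prod_append, mul_assoc, mul_comm M.prod])
        obtain ⟨rfl, rfl⟩ := this
        simp

/-- In an abelian group with an additive weight `w : C → ℤ`, a finite set whose weight-zero part is
sequenceable is itself sequenceable. -/
theorem isSequenceable_of_weight_zero_part (w : C → ℤ) (hw : ∀ x y, w (x * y) = w x + w y)
    (S : Finset C) (h1S : (1 : C) ∉ S) (hZ : IsSequenceable (S.filter fun x => w x = 0)) :
    IsSequenceable S := by
  classical
  rw [isSequenceable_iff_block] at hZ ⊢
  have h1 : w 1 = 0 := by simpa using hw 1 1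
  obtain ⟨zs, hzn, hzm, hzs⟩ := hZ
  have hzw : ∀ x ∈ zs, w x = 0 := fun x hx => (Finset.mem_filter.1 ((hzm x).1 hx)).2
  suffices ∃ l : List C, l.Perm (zs ++ ((S.filter fun x => 0 < w x).toList ++
      (S.filter fun x => w x < 0).toList)) ∧
      ∀ v, v <:+: l → v ≠ [] → v.prod = 1 → v = l by
    obtain ⟨l, hperm, hl⟩ := this
    refine ⟨l, hperm.nodup_iff.2 ?_, fun x => ?_, hl⟩
    · simp only [List.nodup_append', Finset.nodup_toList, hzn, List.disjoint_left, true_and,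
        List.mem_append, hzm, Finset.mem_toList, Finset.mem_filter]
      grind
    · simp only [hperm.mem_iff, List.mem_append, hzm, Finset.mem_toList, Finset.mem_filter]
      grind
  have hP : ∀ x ∈ (S.filter fun x => 0 < w x).toList, 0 < w x := by simp
  have hN : ∀ x ∈ (S.filter fun x => w x < 0).toList, w x < 0 := by simp
  have hPn := (S.filter fun x => 0 < w x).nodup_toList
  have hNn := (S.filter fun x => w x < 0).nodup_toList
  generalize (S.filter fun x => 0 < w x).toList = P at *
  generalize (S.filter fun x => w x < 0).toList = N at *
  by_cases hz1 : zs ≠ [] → zs.prod ≠ 1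
  · obtain ⟨P', N', hP', hN', hh⟩ := exists_ascend_descend w hw P zs N hP hzw hN hPn hNn
      (fun v hv hv0 hp => hz1 (by rintro rfl; simp at hv; contradiction)
        (hzs v hv hv0 hp ▸ hp))
    exact ⟨_, by clear * - hP' hN'; grind, hh⟩
  push Not at hz1
  obtain ⟨hz0, hz1⟩ := hz1
  by_cases hPN : P = [] ∧ N = []
  · obtain ⟨rfl, rfl⟩ := hPN
    exact ⟨zs, by simp, hzs⟩
  wlog hge : 0 ≤ w P.prod + w N.prod generalizing P N w
  · obtain ⟨l, hl, hl'⟩ := this (fun x => - w x) (fun x y => by simp only [hw]; ring)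
      (by simp only [h1]; rfl) (fun x => by simpa using hzm x) (by simpa using hzw) N
      (by simpa using hN) hNn P (by simpa using hP) hPn (by tauto) (by omega)
    exact ⟨l, hl.trans (List.perm_append_comm.append_left zs), hl'⟩
  have hP0 : P ≠ [] := by
    rintro rfl
    have := (prod_nonpos_of_additive hw N hN).2 (by simpa using hPN)
    simp [h1] at hge
    omega
  obtain ⟨z, M, hzM, hMz, hsub, hzne⟩ : ∃ z M, zs.Perm (z :: M) ∧ M ≠ zs ∧ M <:+: zs ∧
      z ≠ P.prod * N.prod := by
    obtain ⟨a, Q, rfl⟩ := List.exists_cons_of_ne_nil hz0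
    by_cases ha : a = P.prod * N.prod
    · rcases List.eq_nil_or_concat' Q with rfl | ⟨R, b, rfl⟩
      · have : a ∈ S := (Finset.mem_filter.1 ((hzm a).1 (by simp))).1
        simp at hz1
        exact absurd (hz1 ▸ this) h1S
      · refine ⟨b, a :: R, List.perm_append_singleton b (a :: R), by simp, ⟨[], [b], by simp⟩, ?_⟩
        rintro rfl
        simp [← ha] at hzn
    · exact ⟨a, Q, .refl _, by simp, List.infix_cons (List.infix_refl _), ha⟩
  have hMw : ∀ x ∈ M, w x = 0 := fun x hx => hzw x (hsub.subset hx)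
  obtain ⟨P', N', hP', hN', hh⟩ := exists_ascend_descend w hw P M N hP hMw hN hPn hNn
    (fun v hv hv0 hp => hMz (by
      have := hzs v (hv.trans hsub) hv0 hp
      exact hsub.eq_of_length (le_antisymm hsub.length_le (this ▸ hv.length_le))))
  have hprod : (P' ++ (M ++ N')).prod ≠ 1 := by
    intro he
    apply hzne
    rw [hzM.prod_eq, List.prod_cons] at hz1
    rw [List.prod_append, List.prod_append, hP'.prod_eq, hN'.prod_eq] at he
    calc z = z * (P.prod * (M.prod * N.prod)) := by rw [he, mul_one]
      _ = (z * M.prod) * (P.prod * N.prod) := by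
        simp only [mul_assoc, mul_left_comm M.prod]
      _ = _ := by rw [hz1, one_mul]
  refine ⟨z :: (P' ++ (M ++ N')), by clear * - hzM hP' hN'; grind, fun v hv hv0 hp => ?_⟩
  rcases List.infix_cons_iff.1 hv with hv | hv
  swap
  · exact absurd (hh v hv hv0 hp ▸ hp) hprod
  rcases List.prefix_cons_iff.1 hv with rfl | ⟨t, rfl, r, hr⟩
  · contradiction
  have hzS : z ∈ zs := hzM.mem_iff.2 (by simp)
  have hwz := hzw z hzS
  have hwt : w t.prod = 0 := by
    have : w (z :: t).prod = 0 := by rw [hp, h1]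
    rw [List.prod_cons, hw] at this
    omega
  have hMz0 := prod_eq_zero_of_additive hw M hMw
  by_contra hne
  have hr0 : r ≠ [] := by
    rintro rfl
    rw [List.append_nil] at hr
    exact hne (by rw [hr])
  have ht0 : t ≠ [] := by
    rintro rfl
    have : z = 1 := by simpa using hp
    exact h1S (this ▸ (Finset.mem_filter.1 ((hzm z).1 hzS)).1)
  have hpre : t <+: P' ++ (M ++ N') := ⟨r, hr⟩
  rcases List.prefix_append_iff_exists.1 hpre with ht | ⟨t', rfl, ht⟩
  · have := (prod_nonneg_of_additive hw t fun x hx => hP x (hP'.subset (ht.subset hx))).2 ht0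
    omega
  have hPpos := (prod_nonneg_of_additive hw P hP).2 hP0
  rw [List.prod_append, hw, hP'.prod_eq] at hwt
  rcases List.prefix_append_iff_exists.1 ht with ht | ⟨n, rfl, u, rfl⟩
  · have := prod_eq_zero_of_additive hw t' fun x hx => hMw x (ht.subset hx)
    omega
  · have hru : r = u := by simpa using hr
    subst hru
    have := (prod_nonpos_of_additive hw r fun x hx =>
      hN x (hN'.subset (List.mem_append_right _ hx))).2 hr0
    rw [← hN'.prod_eq, List.prod_append, hw] at hge
    rw [List.prod_append, hw] at hwt
    omega

end Additive

section Cocycle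

variable {G : Type*} [Group G] (ε : G →* ℤˣ) (w : G → ℤ)

/-- Along the word `l`, read with initial sign `s`, the weights multiplied by the current sign are
nonnegative. -/
def SignedAscending : ℤˣ → List G → Prop
  | _, [] => True
  | s, x :: l => 0 ≤ (s : ℤ) * w x ∧ SignedAscending (s * ε x) l

variable {ε w}

theorem SignedAscending.exists_of_block {s : ℤˣ} {l v : List G} (h : SignedAscending ε w s l)
    (hv : v <:+: l) : ∃ s', SignedAscending ε w s' v := by
  have of_initial : ∀ (v l : List G) (s : ℤˣ), SignedAscending ε w s l → v <+: l →
      SignedAscending ε w s v := by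
    intro v
    induction v with
    | nil => exact fun _ _ _ _ => trivial
    | cons a v ih =>
      rintro _ s h ⟨r, rfl⟩
      exact ⟨h.1, ih _ _ h.2 (List.prefix_append _ _)⟩
  induction l generalizing s with
  | nil => exact ⟨s, by simp_all⟩
  | cons a l ih =>
    rcases List.infix_cons_iff.1 hv with hv | hv
    · exact ⟨s, of_initial _ _ _ h hv⟩
    · exact ih h.2 hv

theorem SignedAscending.prod (hw : ∀ x y, w (x * y) = w x + (ε x : ℤ) * w y) {s : ℤˣ}
    {l : List G} (h : SignedAscending ε w s l) :
    0 ≤ (s : ℤ) * w l.prod ∧ (w l.prod = 0 → ∀ x ∈ l, w x = 0) := by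
  have h1 : w 1 = 0 := by simpa using hw 1 1
  induction l generalizing s with
  | nil => simp [h1]
  | cons a l ih =>
    obtain ⟨h0, hl⟩ := h
    obtain ⟨ih0, ih1⟩ := ih hl
    have hexp : (s : ℤ) * w (a :: l).prod = s * w a + ((s * ε a : ℤˣ) : ℤ) * w l.prod := by
      rw [List.prod_cons, hw]
      push_cast
      ring
    refine ⟨by omega, fun hz => ?_⟩
    rw [hz, mul_zero] at hexp
    have ha : w a = 0 := by
      have : (s : ℤ) * w a = 0 := by omega
      simpa using this
    have hl0 : w l.prod = 0 := by
      have : ((s * ε a : ℤˣ) : ℤ) * w l.prod = 0 := by omega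
      simpa using this
    simpa [ha] using ih1 hl0

/-- Greedy interleaving of the elements of nonzero weight with a fixed word `zs` in the elements of
weight zero. The elements of `A` and `P` fit the current sign `s`, those of `B` and `N` fit the
opposite sign, and the sign is changed by the elements of `A`, `B` and of `zs` on which `ε` is
`-1`. -/
theorem exists_signedAscending (s : ℤˣ) (A B P N zs : List G)
    (hA : ∀ x ∈ A, ε x = -1 ∧ 0 < (s : ℤ) * w x) (hB : ∀ x ∈ B, ε x = -1 ∧ (s : ℤ) * w x < 0)
    (hP : ∀ x ∈ P, ε x = 1 ∧ 0 < (s : ℤ) * w x) (hN : ∀ x ∈ N, ε x = 1 ∧ (s : ℤ) * w x < 0)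
    (hZ : ∀ x ∈ zs, w x = 0)
    (hAB : A.length ≤ B.length + zs.countP (ε · = -1) + 1)
    (hBA : B.length ≤ A.length + zs.countP (ε · = -1))
    (hN0 : N ≠ [] → 1 ≤ A.length + B.length + zs.countP (ε · = -1)) :
    ∃ l : List G, l.Perm (A ++ B ++ P ++ N ++ zs) ∧ SignedAscending ε w s l ∧
      l.filter (w · = 0) = zs ∧ (A ≠ [] ∨ P ≠ [] → ∃ u l', l = u :: l' ∧ w u ≠ 0) := by
  classical
  induction hk : A.length + B.length + P.length + N.length + zs.length
    generalizing s A B P N zs with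
  | zero =>
    have : A = [] ∧ B = [] ∧ P = [] ∧ N = [] ∧ zs = [] := by
      simp only [← List.length_eq_zero_iff]; omega
    obtain ⟨rfl, rfl, rfl, rfl, rfl⟩ := this
    exact ⟨[], by simp, trivial, by simp, by simp⟩
  | succ k ih =>
  rcases P with _ | ⟨p, P⟩
  swap
  · obtain ⟨hp1, hp⟩ := hP p List.mem_cons_self
    obtain ⟨l, hl, hasc, hf, -⟩ := ih s A B P N zs hA hB
      (fun x hx => hP x (List.mem_cons_of_mem _ hx)) hN hZ hAB hBA hN0
      (by simp only [List.length_cons] at hk; omega)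
    have hp0 : w p ≠ 0 := fun h => by simp [h] at hp
    exact ⟨p :: l, by clear * - hl; grind, ⟨hp.le, by rwa [hp1, mul_one]⟩, by simpa [hp0] using hf,
      fun _ => ⟨p, l, rfl, hp0⟩⟩
  rcases A with _ | ⟨a, A⟩
  swap
  · obtain ⟨ha1, ha⟩ := hA a List.mem_cons_self
    simp only [List.length_cons] at hk hAB hBA
    obtain ⟨l, hl, hasc, hf, -⟩ := ih (-s) B A N [] zs
      (fun x hx => ⟨(hB x hx).1, by have := (hB x hx).2; push_cast; linarith⟩)
      (fun x hx => ⟨(hA x (List.mem_cons_of_mem _ hx)).1, by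
        have := (hA x (List.mem_cons_of_mem _ hx)).2; push_cast; linarith⟩)
      (fun x hx => ⟨(hN x hx).1, by have := (hN x hx).2; push_cast; linarith⟩)
      (by simp) hZ (by omega) (by omega) (by simp) (by simp at hk ⊢; omega)
    have ha0 : w a ≠ 0 := fun h => by simp [h] at ha
    exact ⟨a :: l, by clear * - hl; grind, ⟨ha.le, by rwa [ha1, mul_neg_one]⟩,
      by simpa [ha0] using hf, fun _ => ⟨a, l, rfl, ha0⟩⟩
  rcases zs with _ | ⟨z, zs⟩
  · exfalso
    have hB0 : B = [] := by simpa using hBA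
    subst hB0
    have hN1 : N = [] := by by_contra h; simpa using hN0 h
    subst hN1
    simp at hk
  · have hz := hZ z List.mem_cons_self
    have hZ' : ∀ x ∈ zs, w x = 0 := fun x hx => hZ x (List.mem_cons_of_mem _ hx)
    rcases Int.units_eq_one_or (ε z) with hz1 | hz1
    · have hc : (z :: zs).countP (ε · = -1) = zs.countP (ε · = -1) := by
        rw [List.countP_cons_of_neg]; simp [hz1]
      rw [hc] at hAB hBA hN0
      obtain ⟨l, hl, hasc, hf, -⟩ := ih s [] B [] N zs hA hB hP hN hZ' hAB hBA hN0
        (by simp at hk ⊢; omega)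
      exact ⟨z :: l, by clear * - hl; grind, ⟨by simp [hz], by rwa [hz1, mul_one]⟩,
        by simpa [hz] using hf, by simp⟩
    · have hc : (z :: zs).countP (ε · = -1) = zs.countP (ε · = -1) + 1 := by
        rw [List.countP_cons_of_pos]; simp [hz1]
      rw [hc] at hAB hBA hN0
      simp only [List.length_nil] at hAB hBA
      obtain ⟨l, hl, hasc, hf, -⟩ := ih (-s) B [] N [] zs
        (fun x hx => ⟨(hB x hx).1, by have := (hB x hx).2; push_cast; linarith⟩) (by simp)
        (fun x hx => ⟨(hN x hx).1, by have := (hN x hx).2; push_cast; linarith⟩) (by simp)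
        hZ' (by omega) (by simp) (by simp) (by simp at hk ⊢; omega)
      exact ⟨z :: l, by clear * - hl; grind, ⟨by simp [hz], by rwa [hz1, mul_neg_one]⟩,
        by simpa [hz] using hf, by simp⟩

theorem even_countP_of_prod_eq_one (l : List G) (h : l.prod = 1) :
    Even (l.countP (ε · = -1)) := by
  have key : ∀ l : List G, ε l.prod = (-1) ^ l.countP (ε · = -1) := by
    intro l
    induction l with
    | nil => simp
    | cons a l ih =>
      rw [List.prod_cons, map_mul, ih]
      rcases Int.units_eq_one_or (ε a) with ha | ha
      · rw [List.countP_cons_of_neg (by simp [ha]), ha, one_mul]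
      · rw [List.countP_cons_of_pos (by simp [ha]), ha, pow_succ']
  by_contra hodd
  have := key l
  rw [h, map_one, (Nat.not_even_iff_odd.1 hodd).neg_one_pow] at this
  exact absurd this (by decide)

/-- A finite set is sequenceable if its weight-zero part is, provided that the sign-reversing
elements of positive and of negative weight are balanced by those of weight zero. -/
theorem isSequenceable_of_balanced (hw : ∀ x y, w (x * y) = w x + (ε x : ℤ) * w y)
    (S : Finset G) (h1S : (1 : G) ∉ S) (hZ : IsSequenceable (S.filter fun x => w x = 0))
    (hAB : (S.filter fun x => ε x = -1 ∧ 0 < w x).card ≤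
      (S.filter fun x => ε x = -1 ∧ w x < 0).card + (S.filter fun x => ε x = -1 ∧ w x = 0).card)
    (hBA : (S.filter fun x => ε x = -1 ∧ w x < 0).card <
      (S.filter fun x => ε x = -1 ∧ 0 < w x).card + (S.filter fun x => ε x = -1 ∧ w x = 0).card)
    (he : 0 < (S.filter fun x => ε x = -1 ∧ w x = 0).card) :
    IsSequenceable S := by
  classical
  rw [isSequenceable_iff_block] at hZ ⊢
  have h1 : w 1 = 0 := by simpa using hw 1 1
  obtain ⟨zs, hzn, hzm, hzs⟩ := hZ
  have hzw : ∀ x ∈ zs, w x = 0 := fun x hx => (Finset.mem_filter.1 ((hzm x).1 hx)).2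
  have hcount : (S.filter fun x => ε x = -1 ∧ w x = 0).card = zs.countP (ε · = -1) := by
    rw [List.countP_eq_length_filter, ← List.toFinset_card_of_nodup (hzn.filter _)]
    congr 1
    ext x
    simp only [Finset.mem_filter, List.mem_toFinset, List.mem_filter, hzm, decide_eq_true_eq]
    tauto
  suffices ∃ l : List G, l.Perm ((S.filter fun x => ε x = -1 ∧ 0 < w x).toList ++
      (S.filter fun x => ε x = -1 ∧ w x < 0).toList ++
      (S.filter fun x => ε x = 1 ∧ 0 < w x).toList ++
      (S.filter fun x => ε x = 1 ∧ w x < 0).toList ++ zs) ∧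
      ∀ v, v <:+: l → v ≠ [] → v.prod = 1 → v = l by
    obtain ⟨l, hperm, hl⟩ := this
    have hne : (1 : ℤˣ) ≠ -1 := by decide
    refine ⟨l, hperm.nodup_iff.2 ?_, fun x => ?_, hl⟩
    · simp only [List.nodup_append', Finset.nodup_toList, hzn, List.disjoint_left, true_and,
        List.mem_append, hzm, Finset.mem_toList, Finset.mem_filter]
      clear * - hne
      grind
    · simp only [hperm.mem_iff, List.mem_append, hzm, Finset.mem_toList, Finset.mem_filter]
      have := Int.units_eq_one_or (ε x)
      have := lt_trichotomy (w x) 0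
      tauto
  rw [hcount] at hAB hBA he
  rw [← Finset.length_toList, ← Finset.length_toList] at hAB hBA
  have hA : ∀ x ∈ (S.filter fun x => ε x = -1 ∧ 0 < w x).toList, ε x = -1 ∧ 0 < w x := by
    intro x; simp
  have hB : ∀ x ∈ (S.filter fun x => ε x = -1 ∧ w x < 0).toList, ε x = -1 ∧ w x < 0 := by
    intro x; simp
  have hP : ∀ x ∈ (S.filter fun x => ε x = 1 ∧ 0 < w x).toList, ε x = 1 ∧ 0 < w x := by
    intro x; simp
  have hN : ∀ x ∈ (S.filter fun x => ε x = 1 ∧ w x < 0).toList, ε x = 1 ∧ w x < 0 := by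
    intro x; simp
  generalize (S.filter fun x => ε x = -1 ∧ 0 < w x).toList = A at *
  generalize (S.filter fun x => ε x = -1 ∧ w x < 0).toList = B at *
  generalize (S.filter fun x => ε x = 1 ∧ 0 < w x).toList = P at *
  generalize (S.filter fun x => ε x = 1 ∧ w x < 0).toList = N at *
  -- a block with product `1` of an ascending word is a block of the zero-weight word
  have block : ∀ (s : ℤˣ) (l v : List G), SignedAscending ε w s l → v <:+: l → v.prod = 1 →
      (∀ x ∈ v, w x = 0) ∧ v <:+: l.filter (w · = 0) := by
    intro s l v hasc hv hp
    obtain ⟨s', hs'⟩ := hasc.exists_of_block hv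
    have hv0 := (hs'.prod hw).2 (by rw [hp, h1])
    refine ⟨hv0, ?_⟩
    have := hv.filter (w · = 0)
    rwa [List.filter_eq_self.2 (by simpa using hv0)] at this
  by_cases hz1 : zs.prod = 1
  swap
  · obtain ⟨l, hl, hasc, hf, -⟩ := exists_signedAscending (1 : ℤˣ) A B P N zs (by simpa using hA)
      (by simpa using hB) (by simpa using hP) (by simpa using hN) hzw (by omega) (by omega)
      (fun _ => by omega)
    refine ⟨l, hl, fun v hv hv0 hp => ?_⟩
    have := (block 1 l v hasc hv hp).2
    rw [hf] at this
    exact absurd (hzs v this hv0 hp ▸ hp) hz1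
  by_cases hnil : A = [] ∧ B = [] ∧ P = [] ∧ N = []
  · obtain ⟨rfl, rfl, rfl, rfl⟩ := hnil
    exact ⟨zs, by simp, hzs⟩
  obtain ⟨r, hr⟩ := even_countP_of_prod_eq_one (ε := ε) zs hz1
  rcases zs with _ | ⟨z, zs⟩
  · simp at he
  have hcz : (z :: zs).countP (ε · = -1) ≤ zs.countP (ε · = -1) + 1 := by
    rw [List.countP_cons]; split <;> omega
  have hcz' : zs.countP (ε · = -1) ≤ (z :: zs).countP (ε · = -1) := by
    rw [List.countP_cons]; omega
  have hzw' : ∀ x ∈ zs, w x = 0 := fun x hx => hzw x (List.mem_cons_of_mem _ hx)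
  have hz0 := hzw z List.mem_cons_self
  have hz1S : z ≠ 1 := by
    rintro rfl
    exact h1S (Finset.mem_filter.1 ((hzm 1).1 List.mem_cons_self)).1
  obtain ⟨σ, l, hl, hasc, hf, u, l', rfl, hu⟩ : ∃ (σ : ℤˣ) (l : List G),
      l.Perm (A ++ B ++ P ++ N ++ zs) ∧ SignedAscending ε w σ l ∧ l.filter (w · = 0) = zs ∧
      ∃ u l', l = u :: l' ∧ w u ≠ 0 := by
    by_cases hAP : A ≠ [] ∨ P ≠ []
    · obtain ⟨l, hl, hasc, hf, hhead⟩ := exists_signedAscending (1 : ℤˣ) A B P N zs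
        (by simpa using hA) (by simpa using hB) (by simpa using hP) (by simpa using hN) hzw'
        (by omega) (by omega) (fun _ => by omega)
      exact ⟨1, l, hl, hasc, hf, hhead hAP⟩
    · push Not at hAP
      obtain ⟨rfl, rfl⟩ := hAP
      simp only [List.length_nil] at hAB hBA
      obtain ⟨l, hl, hasc, hf, hhead⟩ := exists_signedAscending (-1 : ℤˣ) B [] N [] zs
        (by simpa using hB) (by simp) (by simpa using hN) (by simp) hzw'
        (by simp only [List.length_nil]; omega) (by simp) (by simp)
      exact ⟨-1, l, by simpa using hl, hasc, hf, hhead (by simp at hnil; tauto)⟩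
  have hasc' : SignedAscending ε w (σ * ε z) (z :: u :: l') :=
    ⟨by simp [hz0], by rwa [mul_assoc, Int.units_mul_self, mul_one]⟩
  refine ⟨z :: u :: l', by clear * - hl; grind, fun v hv hv0 hp => ?_⟩
  have hvw := (block _ _ v hasc' hv hp).1
  exfalso
  rcases List.infix_cons_iff.1 hv with hv | hv
  · rcases List.prefix_cons_iff.1 hv with rfl | ⟨t, rfl, ht⟩
    · contradiction
    rcases List.prefix_cons_iff.1 ht with rfl | ⟨t, rfl, ht⟩
    · exact hz1S (by simpa using hp)
    · exact hu (hvw u (by simp))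
  · have hvz := (block _ _ v hasc hv hp).2
    rw [hf] at hvz
    have := hzs v (List.infix_cons hvz) hv0 hp
    have hle := hvz.length_le
    rw [this] at hle
    simp at hle

/-- A median of the values of `f` on a nonempty finite set. -/
theorem exists_median {α : Type*} (T : Finset α) (hT : T.Nonempty) (f : α → ℤ) :
    ∃ c : ℤ, 2 * (T.filter fun x => c < f x).card ≤ T.card ∧
      2 * (T.filter fun x => f x < c).card < T.card := by
  have hbdd : ∃ b : ℤ, ∀ c, 2 * (T.filter fun x => c < f x).card ≤ T.card → b ≤ c := by
    obtain ⟨b, hb⟩ := (T.image f).bddBelow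
    refine ⟨b, fun c hc => ?_⟩
    by_contra hlt
    rw [Finset.filter_true_of_mem fun x hx => by
      have := hb (Finset.mem_coe.2 (Finset.mem_image_of_mem f hx)); omega] at hc
    have := hT.card_pos
    omega
  have hex : ∃ c : ℤ, 2 * (T.filter fun x => c < f x).card ≤ T.card := by
    obtain ⟨b, hb⟩ := (T.image f).bddAbove
    refine ⟨b, ?_⟩
    rw [Finset.filter_false_of_mem fun x hx => by
      have := hb (Finset.mem_coe.2 (Finset.mem_image_of_mem f hx)); omega]
    simp
  obtain ⟨c, hc, hmin⟩ := Int.exists_least_of_bdd hbdd hex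
  refine ⟨c, hc, ?_⟩
  have hlt : ¬ 2 * (T.filter fun x => c - 1 < f x).card ≤ T.card := fun h => by
    have := hmin _ h
    omega
  have hsplit := T.card_filter_add_card_filter_not fun x => f x < c
  have : (T.filter fun x => ¬ f x < c) = T.filter fun x => c - 1 < f x :=
    Finset.filter_congr fun x _ => by omega
  rw [this] at hsplit
  omega

end Cocycle

/-- A group mapping to a strongly sequenceable abelian group `H`, with kernel separated by a
`ℤ`-valued cocycle for a sign character of `H`, is strongly sequenceable. -/
theorem StronglySequenceable.of_cocycle {G H : Type*} [Group G] [CommGroup H]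
    (hH : StronglySequenceable H) (π : G →* H) (χ : H →* ℤˣ) (w : G → ℤ)
    (hw : ∀ x y, w (x * y) = w x + (χ (π x) : ℤ) * w y)
    (hinj : ∀ x y, π x = π y → w x = w y → x = y) : StronglySequenceable G := by
  classical
  intro S h1S
  have h1 : w 1 = 0 := by simpa using hw 1 1
  by_cases hT : (S.filter fun x => χ (π x) = -1).Nonempty
  · obtain ⟨c, hc1, hc2⟩ := exists_median _ hT w
    have hexp : ∀ x, χ (π x) = -1 →
        2 * w x - c * (1 - (χ (π x) : ℤ)) = 2 * (w x - c) := fun x hx => by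
      rw [hx]; push_cast; ring
    have hf0 : (S.filter fun x => χ (π x) = -1 ∧ 2 * w x - c * (1 - (χ (π x) : ℤ)) = 0) =
        (S.filter fun x => χ (π x) = -1).filter fun x => w x = c := by
      rw [Finset.filter_filter]
      exact Finset.filter_congr fun x _ => and_congr_right fun hx => by rw [hexp x hx]; omega
    have hfp : (S.filter fun x => χ (π x) = -1 ∧ 0 < 2 * w x - c * (1 - (χ (π x) : ℤ))) =
        (S.filter fun x => χ (π x) = -1).filter fun x => c < w x := by
      rw [Finset.filter_filter]
      exact Finset.filter_congr fun x _ => and_congr_right fun hx => by rw [hexp x hx]; omega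
    have hfn : (S.filter fun x => χ (π x) = -1 ∧ 2 * w x - c * (1 - (χ (π x) : ℤ)) < 0) =
        (S.filter fun x => χ (π x) = -1).filter fun x => w x < c := by
      rw [Finset.filter_filter]
      exact Finset.filter_congr fun x _ => and_congr_right fun hx => by rw [hexp x hx]; omega
    have hcard : (S.filter fun x => χ (π x) = -1).card =
        ((S.filter fun x => χ (π x) = -1).filter fun x => c < w x).card +
        ((S.filter fun x => χ (π x) = -1).filter fun x => w x < c).card +
        ((S.filter fun x => χ (π x) = -1).filter fun x => w x = c).card := by
      generalize (S.filter fun x => χ (π x) = -1) = T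
      rw [← T.card_filter_add_card_filter_not fun x => c < w x, add_assoc,
        ← (T.filter fun x => ¬ c < w x).card_filter_add_card_filter_not fun x => w x < c,
        Finset.filter_filter, Finset.filter_filter]
      congr 3 <;> exact Finset.filter_congr fun x _ => by omega
    refine isSequenceable_of_balanced (ε := χ.comp π)
      (w := fun x => 2 * w x - c * (1 - (χ (π x) : ℤ))) (fun x y => ?_) S h1S ?_ ?_ ?_ ?_
    · simp only [hw, map_mul, MonoidHom.comp_apply]
      push_cast
      ring
    · refine IsSequenceable.of_image π (fun x hx y hy hxy => hinj x y hxy ?_)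
        (fun v _ hv => by rw [← map_list_prod, hv, map_one]) (hH _ fun h => ?_)
      · have hx := (Finset.mem_filter.1 hx).2
        have hy := (Finset.mem_filter.1 hy).2
        rw [hxy] at hx
        omega
      · obtain ⟨x, hx, hx1⟩ := Finset.mem_image.1 h
        obtain ⟨hxS, hx0⟩ := Finset.mem_filter.1 hx
        rw [hx1, map_one] at hx0
        have : x = 1 := hinj x 1 (by rw [hx1, map_one]) (by simpa [h1] using hx0)
        exact h1S (this ▸ hxS)
    all_goals
      simp only [MonoidHom.comp_apply, hf0, hfp, hfn]
      omega
  · have hχ : ∀ x ∈ S, χ (π x) = 1 := fun x hx =>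
      (Int.units_eq_one_or _).resolve_right fun h => hT ⟨x, Finset.mem_filter.2 ⟨hx, h⟩⟩
    have hmem : ∀ x ∈ S, π x = 1 → w x ≠ 0 := fun x hx hx1 hx0 => by
      have : x = 1 := hinj x 1 (by rw [hx1, map_one]) (by rw [hx0, h1])
      exact h1S (this ▸ hx)
    have hprod : ∀ v : List G, (∀ x ∈ v, x ∈ S) →
        (v.map fun x => (Multiplicative.ofAdd (w x), π x)).prod =
          (Multiplicative.ofAdd (w v.prod), π v.prod) := by
      intro v hv
      induction v with
      | nil => simp only [List.map_nil, List.prod_nil, h1, map_one]; rfl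
      | cons a v ih =>
        rw [List.map_cons, List.prod_cons, ih fun x hx => hv x (List.mem_cons_of_mem _ hx),
          List.prod_cons, hw, hχ a (hv a List.mem_cons_self)]
        simp
    refine IsSequenceable.of_image (fun x => (Multiplicative.ofAdd (w x), π x))
      (fun x _ y _ hxy => ?_) (fun v hv hp => ?_) ?_
    · simp only [Prod.mk.injEq] at hxy
      exact hinj x y hxy.2 (Multiplicative.ofAdd.injective hxy.1)
    · rw [hprod v hv, hp, h1, map_one]
      rfl
    · refine isSequenceable_of_weight_zero_part (fun y => y.1.toAdd) (fun x y => by simp) _ ?_ ?_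
      · intro h
        obtain ⟨x, hx, hx1⟩ := Finset.mem_image.1 h
        simp only [Prod.ext_iff] at hx1
        exact hmem x hx hx1.2 hx1.1
      · refine IsSequenceable.of_image (MonoidHom.snd _ _) (fun x hx y hy hxy => ?_)
          (fun v _ hv => by rw [← map_list_prod, hv, map_one]) (hH _ fun h => ?_)
        · have hx := (Finset.mem_filter.1 hx).2
          have hy := (Finset.mem_filter.1 hy).2
          exact Prod.ext (Multiplicative.toAdd.injective (hx.trans hy.symm)) hxy
        · obtain ⟨y, hy, hy1⟩ := Finset.mem_image.1 h
          obtain ⟨hyS, hy0⟩ := Finset.mem_filter.1 hy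
          obtain ⟨x, hx, rfl⟩ := Finset.mem_image.1 hyS
          exact hmem x hx hy1 hy0

/-- Automorphisms of the infinite cyclic group act by signs. -/
theorem exists_sign_hom {H : Type*} [Group H] (φ : H →* MulAut (Multiplicative ℤ)) :
    ∃ χ : H →* ℤˣ, ∀ h (x : Multiplicative ℤ), (φ h x).toAdd = (χ h : ℤ) * x.toAdd := by
  have key : ∀ (f : MulAut (Multiplicative ℤ)) (x : Multiplicative ℤ),
      (f x).toAdd = (f (Multiplicative.ofAdd 1)).toAdd * x.toAdd := by
    intro f x
    have hx : x = Multiplicative.ofAdd (1 : ℤ) ^ x.toAdd := by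
      rw [← ofAdd_zsmul]
      simp
    conv_lhs => rw [hx, map_zpow]
    rw [toAdd_zpow, smul_eq_mul, mul_comm]
  have hmul : ∀ f g : MulAut (Multiplicative ℤ), ((f * g) (Multiplicative.ofAdd 1)).toAdd =
      (f (Multiplicative.ofAdd 1)).toAdd * (g (Multiplicative.ofAdd 1)).toAdd := fun f g => by
    rw [MulAut.mul_apply, key]
  let ψ : H →* ℤ :=
    { toFun := fun h => (φ h (Multiplicative.ofAdd 1)).toAdd
      map_one' := by simp
      map_mul' := fun a b => by rw [map_mul, hmul] }
  exact ⟨ψ.toHomUnits, fun h x => key (φ h) x⟩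

/-- If `H` is a finite abelian strongly sequenceable group and `φ : H → Aut(ℤ)` is a
group homomorphism, then every finite subset of `(ℤ ⋊_φ H) \ {0}` is sequenceable. -/
theorem semidirect_int_sequenceable (H : Type*) [CommGroup H] [Fintype H]
    (hH : StronglySequenceable H) (φ : H →* MulAut (Multiplicative ℤ))
    (S : Finset (SemidirectProduct (Multiplicative ℤ) H φ))
    (h1 : (1 : SemidirectProduct (Multiplicative ℤ) H φ) ∉ S) :
    IsSequenceable S := by
  obtain ⟨χ, hχ⟩ := exists_sign_hom φ
  refine hH.of_cocycle SemidirectProduct.rightHom χ (fun g => g.left.toAdd) (fun x y => ?_)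
    (fun x y hr hl => SemidirectProduct.ext (Multiplicative.toAdd.injective hl) hr) S h1
  simp [hχ]
end
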